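/- There exist a positive integer n < 7.8×10³², a positive integer d, weights w_1,…,w_d ≥ 0 with ∑_{i=1}^d w_i = 1, and unitary n×n matrices U_1,…,U_d whose random unitary channel Φ satisfies S_min(Φ) > log d − (log d)/(2d). -/

import Mathlib

open scoped BigOperators ComplexOrder
open Matrix

/-- Von Neumann entropy of a (Hermitian) matrix, via its eigenvalues;
`Real.log 0 = 0` gives the convention `0 · log 0 = 0`. -/
noncomputable def vnEntropy {m : Type*} [Fintype m] [DecidableEq m] (ρ : Matrix m m ℂ) : ℝ :=
  if h : ρ.IsHermitian then -∑ i, h.eigenvalues i * Real.log (h.eigenvalues i) else 0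

/-- Minimal output entropy of a channel: infimum of output entropies over density matrices. -/
noncomputable def minOutEntropy {m k : Type*} [Fintype m] [DecidableEq m] [Fintype k]
    [DecidableEq k] (Ψ : Matrix m m ℂ → Matrix k k ℂ) : ℝ :=
  sInf {x : ℝ | ∃ ρ : Matrix m m ℂ, ρ.PosSemidef ∧ ρ.trace = 1 ∧ x = vnEntropy (Ψ ρ)}

/-- The random unitary channel `ρ ↦ ∑ i, w i • U i ρ (U i)ᴴ`. -/
noncomputable def ruChannel {n d : ℕ} (w : Fin d → ℝ) (U : Fin d → Matrix (Fin n) (Fin n) ℂ)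
    (ρ : Matrix (Fin n) (Fin n) ℂ) : Matrix (Fin n) (Fin n) ℂ :=
  ∑ i, (w i : ℂ) • (U i * ρ * (U i)ᴴ)

/-- The complex conjugate channel `ρ ↦ ∑ i, w i • conj (U i) ρ (U i)ᵀ`. -/
noncomputable def conjRuChannel {n d : ℕ} (w : Fin d → ℝ) (U : Fin d → Matrix (Fin n) (Fin n) ℂ)
    (ρ : Matrix (Fin n) (Fin n) ℂ) : Matrix (Fin n) (Fin n) ℂ :=
  ∑ i, (w i : ℂ) • ((U i).map star * ρ * (U i)ᵀ)

open Kronecker in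
/-- The product channel `Φ ⊗ Φ̄` acting on `n² × n²` matrices via Kronecker products. -/
noncomputable def prodChannel {n d : ℕ} (w : Fin d → ℝ) (U : Fin d → Matrix (Fin n) (Fin n) ℂ)
    (ρ : Matrix (Fin n × Fin n) (Fin n × Fin n) ℂ) :
    Matrix (Fin n × Fin n) (Fin n × Fin n) ℂ :=
  ∑ i, ∑ j, ((w i * w j : ℝ) : ℂ) •
    ((U i ⊗ₖ (U j).map star) * ρ * (U i ⊗ₖ (U j).map star)ᴴ)

section ScalarBounds

/-- Quadratic comparison for `-log (1 - u) - u` on `[-τ, τ]`. -/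
lemma neg_log_one_sub_le {τ u : ℝ} (hτ : 0 < τ) (hτ1 : τ < 1) (hu : |u| ≤ τ) :
    -Real.log (1 - u) ≤ u + (u / τ) ^ 2 * (-Real.log (1 - τ) - τ) := by
  have h1 := Real.hasSum_pow_div_log_of_abs_lt_one (lt_of_le_of_lt hu hτ1)
  have h2 := Real.hasSum_pow_div_log_of_abs_lt_one (x := τ) (by rwa [abs_of_pos hτ])
  have h1' := (hasSum_nat_add_iff' 1).2 h1
  have h2' := ((hasSum_nat_add_iff' 1).2 h2).mul_left ((u / τ) ^ 2)
  have := hasSum_le (fun k => ?_) h1' h2'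
  · simp only [Finset.range_one, Finset.sum_singleton, zero_add, pow_one, Nat.cast_zero,
      div_one] at this
    linarith
  · have e : (u / τ) ^ 2 * (τ ^ (k + 1 + 1) / ((k + 1 : ℕ) + 1 : ℝ)) =
        u ^ 2 * τ ^ k / ((k + 1 : ℕ) + 1 : ℝ) := by
      field_simp
      ring
    rw [e]
    refine div_le_div_of_nonneg_right ?_ (by positivity)
    calc u ^ (k + 1 + 1) = u ^ 2 * u ^ k := by ring
      _ ≤ u ^ 2 * τ ^ k := by
        refine mul_le_mul_of_nonneg_left ?_ (by positivity)
        calc u ^ k ≤ |u ^ k| := le_abs_self _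
          _ = |u| ^ k := abs_pow _ _
          _ ≤ τ ^ k := by gcongr

end ScalarBounds

open MeasureTheory in
/-- Jensen's inequality for the exponential, with a lower integral on the right. -/
lemma ofReal_exp_integral_le_lintegral {α : Type*} [MeasurableSpace α] {μ : Measure α}
    [IsProbabilityMeasure μ] {X : α → ℝ} (hX : Integrable X μ) :
    ENNReal.ofReal (Real.exp (∫ x, X x ∂μ)) ≤ ∫⁻ x, ENNReal.ofReal (Real.exp (X x)) ∂μ := by
  by_cases h : Integrable (fun x => Real.exp (X x)) μ
  · rw [← ofReal_integral_eq_lintegral_ofReal h (ae_of_all _ fun x => (Real.exp_pos _).le)]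
    exact ENNReal.ofReal_le_ofReal (convexOn_exp.map_integral_le Real.continuous_exp.continuousOn
      isClosed_univ (ae_of_all _ fun _ => Set.mem_univ _) hX h)
  · have : ∫⁻ x, ENNReal.ofReal (Real.exp (X x)) ∂μ = ⊤ := by
      by_contra hne
      refine h ⟨hX.aestronglyMeasurable.aemeasurable.exp.aestronglyMeasurable, ?_⟩
      rw [hasFiniteIntegral_iff_ofReal (ae_of_all _ fun x => (Real.exp_pos _).le)]
      exact lt_top_iff_ne_top.2 hne
    rw [this]; exact le_top

section GaussianMeasure

open MeasureTheory

variable {E : Type*} [NormedAddCommGroup E] [InnerProductSpace ℂ E] [FiniteDimensional ℂ E]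
  [InnerProductSpace ℝ E] [IsScalarTower ℝ ℂ E] [FiniteDimensional ℝ E]
  [MeasurableSpace E] [BorelSpace E]

lemma exists_linearIsometryEquiv_apply_eq {u v : E} (h : ‖u‖ = ‖v‖) :
    ∃ T : E ≃ₗᵢ[ℂ] E, T u = v := by
  by_cases hu : u = 0
  · subst hu
    refine ⟨LinearIsometryEquiv.refl ℂ E, ?_⟩
    have : v = 0 := by simpa using h.symm
    simp [this]
  have hu' : ‖u‖ ≠ 0 := norm_ne_zero_iff.2 hu
  have hv : v ≠ 0 := norm_ne_zero_iff.1 (h ▸ hu')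
  let n := Module.finrank ℂ E
  have hn : 0 < n := by
    have : Nontrivial E := ⟨u, 0, hu⟩
    exact Module.finrank_pos
  have key : ∀ w : E, w ≠ 0 → ∃ b : OrthonormalBasis (Fin n) ℂ E, (‖w‖ : ℂ) • b ⟨0, hn⟩ = w := by
    intro w hw
    have hw' : (‖w‖ : ℂ) ≠ 0 := by simpa using hw
    obtain ⟨b, hb⟩ := Orthonormal.exists_orthonormalBasis_extension_of_card_eq (𝕜 := ℂ) (E := E)
      (ι := Fin n) (by simp [n]) (v := fun _ => (‖w‖ : ℂ)⁻¹ • w) (s := {⟨0, hn⟩}) (by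
        refine ⟨fun i => ?_, fun i j hij => absurd (Subsingleton.elim i j) hij⟩
        simp [norm_smul, hw])
    refine ⟨b, ?_⟩
    rw [hb _ rfl, smul_smul, mul_inv_cancel₀ hw', one_smul]
  obtain ⟨b, hb⟩ := key u hu
  obtain ⟨c, hc⟩ := key v hv
  refine ⟨b.equiv c (Equiv.refl _), ?_⟩
  rw [← hc, ← h]
  conv_lhs => rw [← hb]
  rw [map_smul, OrthonormalBasis.equiv_apply_basis, Equiv.refl_apply]

lemma integral_exp_neg_mul_norm_sq {n : ℕ} (hE : Module.finrank ℂ E = n) {b : ℝ} (hb : 0 < b) :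
    ∫ x : E, Real.exp (-b * ‖x‖ ^ 2) = (Real.pi / b) ^ n := by
  rw [GaussianFourier.integral_rexp_neg_mul_sq_norm hb, ← Module.finrank_mul_finrank ℝ ℂ E, Complex.finrank_real_complex, hE,
    ← Real.rpow_natCast]
  congr 1
  push_cast; ring

lemma integrable_exp_neg_mul_norm_sq {b : ℝ} (hb : 0 < b) :
    Integrable (fun x : E => Real.exp (-b * ‖x‖ ^ 2)) := by
  refine not_imp_comm.1 integral_undef ?_
  rw [integral_exp_neg_mul_norm_sq rfl hb]
  positivity

/-- Density of the complex Gaussian with `E ‖x‖ ^ 2 = 1` in complex dimension `n`. -/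
noncomputable def gaussDensity (n : ℕ) (x : E) : ℝ :=
  (n / Real.pi) ^ n * Real.exp (-n * ‖x‖ ^ 2)

/-- The rotation invariant complex Gaussian measure with `E ‖x‖ ^ 2 = 1`. -/
noncomputable def gaussMeasure (E : Type*) [NormedAddCommGroup E] [InnerProductSpace ℝ E]
    [FiniteDimensional ℝ E] [MeasurableSpace E] [BorelSpace E] (n : ℕ) : Measure E :=
  volume.withDensity fun x : E => ENNReal.ofReal (gaussDensity n x)

lemma gaussDensity_nonneg (n : ℕ) (x : E) : 0 ≤ gaussDensity n x := by
  unfold gaussDensity; positivity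

lemma continuous_gaussDensity (n : ℕ) : Continuous (gaussDensity n : E → ℝ) := by
  unfold gaussDensity; fun_prop

lemma integrable_gaussDensity {n : ℕ} (hn : 0 < n) : Integrable (gaussDensity n : E → ℝ) :=
  (integrable_exp_neg_mul_norm_sq (by positivity)).const_mul _

lemma lintegral_gaussMeasure (n : ℕ) {f : E → ENNReal} (hf : Measurable f) :
    ∫⁻ x, f x ∂(gaussMeasure E n) = ∫⁻ x, ENNReal.ofReal (gaussDensity n x) * f x := by
  unfold gaussMeasure
  rw [lintegral_withDensity_eq_lintegral_mul _
    (continuous_gaussDensity n).measurable.ennreal_ofReal hf]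
  rfl

lemma integral_gaussMeasure (n : ℕ) (f : E → ℝ) :
    ∫ x, f x ∂(gaussMeasure E n) = ∫ x, gaussDensity n x * f x := by
  unfold gaussMeasure
  rw [integral_withDensity_eq_integral_toReal_smul
    (continuous_gaussDensity n).measurable.ennreal_ofReal (by simp)]
  simp [ENNReal.toReal_ofReal, gaussDensity_nonneg]

lemma integral_gaussDensity {n : ℕ} (hn : 0 < n) (hE : Module.finrank ℂ E = n) :
    ∫ x : E, gaussDensity n x = 1 := by
  have : (n : ℝ) ≠ 0 := by positivity
  unfold gaussDensity
  rw [integral_const_mul, integral_exp_neg_mul_norm_sq hE (by positivity), ← mul_pow]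
  field_simp
  simp

lemma isProbabilityMeasure_gaussMeasure {n : ℕ} (hn : 0 < n) (hE : Module.finrank ℂ E = n) :
    IsProbabilityMeasure (gaussMeasure E n) := by
  constructor
  rw [gaussMeasure, withDensity_apply _ MeasurableSet.univ, Measure.restrict_univ,
    ← ofReal_integral_eq_lintegral_ofReal (integrable_gaussDensity hn)
      (ae_of_all _ fun x => gaussDensity_nonneg n x), integral_gaussDensity hn hE]
  simp

lemma measurePreserving_gaussMeasure (n : ℕ) (T : E ≃ₗᵢ[ℂ] E) :
    MeasurePreserving T (gaussMeasure E n) (gaussMeasure E n) := by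
  refine ⟨T.continuous.measurable, ?_⟩
  have hT : MeasurePreserving T (volume : Measure E) volume :=
    LinearIsometryEquiv.measurePreserving
      { toLinearEquiv := T.toLinearEquiv.restrictScalars ℝ, norm_map' := T.norm_map }
  refine Measure.ext_of_lintegral _ fun f hf => ?_
  rw [lintegral_map hf T.continuous.measurable, lintegral_gaussMeasure n hf,
    lintegral_gaussMeasure n (f := fun x => f (T x)) (hf.comp T.continuous.measurable)]
  have := hT.lintegral_comp ((continuous_gaussDensity n).measurable.ennreal_ofReal.mul hf)
  simpa [gaussDensity] using this

lemma integral_norm_pow_gaussMeasure {n : ℕ} (hn : 0 < n) (hE : Module.finrank ℂ E = n) (k : ℕ) :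
    ∫ x : E, ‖x‖ ^ (2 * k) ∂(gaussMeasure E n) =
      Real.Gamma (n + k) / (Real.Gamma n * (n : ℝ) ^ k) := by
  have hn0 : (0 : ℝ) < n := by positivity
  have hd : Module.finrank ℝ E = 2 * n := by rw [← Module.finrank_mul_finrank ℝ ℂ E, Complex.finrank_real_complex, hE]
  obtain ⟨D, hD⟩ : ∃ D : ℝ, ∀ k : ℕ, ∫ x : E, ‖x‖ ^ (2 * k) ∂(gaussMeasure E n) =
      D * (Real.Gamma (n + k) / (n : ℝ) ^ k) := by
    have : Nontrivial E := Module.nontrivial_of_finrank_pos (R := ℂ) (by omega)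
    refine ⟨((n / Real.pi) ^ n) * ((2 * n : ℕ) • (volume : Measure E).real (Metric.ball 0 1)) *
      ((n : ℝ) ^ (-(n : ℝ)) * (1 / 2)), fun k => ?_⟩
    rw [integral_gaussMeasure]
    have h1 := integral_fun_norm_addHaar (volume : Measure E)
      (fun r => r ^ (2 * k) * Real.exp (-n * r ^ 2))
    have h2 : ∫ y in Set.Ioi (0 : ℝ), y ^ (Module.finrank ℝ E - 1) •
        (y ^ (2 * k) * Real.exp (-n * y ^ 2)) =
        (n : ℝ) ^ (-(n : ℝ)) * (1 / 2) * (Real.Gamma (n + k) / (n : ℝ) ^ k) := by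
      have h3 := integral_rpow_mul_exp_neg_mul_rpow (p := 2) (q := 2 * n - 1 + 2 * k) (b := n)
        (by norm_num) (by nlinarith [(Nat.cast_nonneg k : (0:ℝ) ≤ k)]) hn0
      rw [show -(2 * (n : ℝ) - 1 + 2 * k + 1) / 2 = -(n : ℝ) - k by ring,
        show (2 * (n : ℝ) - 1 + 2 * k + 1) / 2 = n + k by ring, Real.rpow_sub hn0,
        Real.rpow_natCast] at h3
      rw [show (n : ℝ) ^ (-(n : ℝ)) * (1 / 2) * (Real.Gamma (n + k) / (n : ℝ) ^ k) =
        (n : ℝ) ^ (-(n : ℝ)) / (n : ℝ) ^ k * (1 / 2) * Real.Gamma (n + k) by ring, ← h3]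
      refine setIntegral_congr_fun measurableSet_Ioi fun y hy => ?_
      have hy : 0 < y := hy
      simp only [smul_eq_mul]
      rw [← mul_assoc, ← pow_add, hd, ← Real.rpow_natCast, Real.rpow_two]
      congr 2
      rw [Nat.cast_add, Nat.cast_sub (by omega)]
      push_cast; ring
    calc ∫ x : E, gaussDensity n x * ‖x‖ ^ (2 * k)
        = ∫ x : E, (n / Real.pi) ^ n * (‖x‖ ^ (2 * k) * Real.exp (-n * ‖x‖ ^ 2)) := by
          congr 1; ext x; unfold gaussDensity; ring
      _ = _ := by
          rw [integral_const_mul, h1, h2, hd, smul_eq_mul, nsmul_eq_mul, nsmul_eq_mul]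
          ring
  have h0 := hD 0
  have := isProbabilityMeasure_gaussMeasure hn hE
  have hG := Real.Gamma_pos_of_pos hn0
  simp at h0
  rw [hD k, eq_div_iff (by positivity)]
  have : Real.Gamma (n + k) / (n : ℝ) ^ k * (n : ℝ) ^ k = Real.Gamma (n + k) := by field_simp
  calc _ = (D * Real.Gamma n) * (Real.Gamma (n + k) / (n : ℝ) ^ k * (n : ℝ) ^ k) := by ring
    _ = _ := by rw [← h0, this, one_mul]

lemma integral_norm_sq_gaussMeasure {n : ℕ} (hn : 0 < n) (hE : Module.finrank ℂ E = n) :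
    ∫ x : E, ‖x‖ ^ 2 ∂(gaussMeasure E n) = 1 := by
  have hn0 : (0 : ℝ) < n := by positivity
  have := integral_norm_pow_gaussMeasure hn hE 1
  have hG := Real.Gamma_pos_of_pos hn0
  rw [Nat.cast_one, Real.Gamma_add_one hn0.ne', mul_one] at this
  rw [this]; field_simp

lemma integral_norm_pow_four_gaussMeasure {n : ℕ} (hn : 0 < n) (hE : Module.finrank ℂ E = n) :
    ∫ x : E, ‖x‖ ^ 4 ∂(gaussMeasure E n) = (1 + 1 / n : ℝ) := by
  have hn0 : (0 : ℝ) < n := by positivity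
  have := integral_norm_pow_gaussMeasure hn hE 2
  have hG := Real.Gamma_pos_of_pos hn0
  rw [show ((n : ℝ) + (2 : ℕ)) = (n + 1) + 1 by push_cast; ring, Real.Gamma_add_one (by positivity),
    Real.Gamma_add_one hn0.ne'] at this
  rw [show (4 : ℕ) = 2 * 2 by norm_num, this]; field_simp

lemma integrable_norm_pow_four_gaussMeasure {n : ℕ} (hn : 0 < n) (hE : Module.finrank ℂ E = n) :
    Integrable (fun x : E => ‖x‖ ^ 4) (gaussMeasure E n) := by
  refine not_imp_comm.1 integral_undef ?_
  rw [integral_norm_pow_four_gaussMeasure hn hE]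
  positivity

lemma integrable_norm_sq_gaussMeasure {n : ℕ} (hn : 0 < n) (hE : Module.finrank ℂ E = n) :
    Integrable (fun x : E => ‖x‖ ^ 2) (gaussMeasure E n) := by
  refine not_imp_comm.1 integral_undef ?_
  rw [integral_norm_sq_gaussMeasure hn hE]
  positivity

lemma integral_norm_sq_sub_one_sq_gaussMeasure {n : ℕ} (hn : 0 < n)
    (hE : Module.finrank ℂ E = n) :
    ∫ x : E, (‖x‖ ^ 2 - 1) ^ 2 ∂(gaussMeasure E n) = (1 / n : ℝ) := by
  have := isProbabilityMeasure_gaussMeasure hn hE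
  have e : ∀ x : E, (‖x‖ ^ 2 - 1) ^ 2 = ‖x‖ ^ 4 - 2 * ‖x‖ ^ 2 + 1 := fun x => by ring
  have h2 := integrable_norm_sq_gaussMeasure (E := E) hn hE
  have h4 := integrable_norm_pow_four_gaussMeasure (E := E) hn hE
  simp_rw [e]
  rw [integral_add (by fun_prop) (by fun_prop), integral_sub h4 (by fun_prop), integral_const_mul,
    integral_norm_pow_four_gaussMeasure hn hE, integral_norm_sq_gaussMeasure hn hE]
  simp; ring

lemma integral_inner_sq_gaussMeasure {n : ℕ} (hn : 0 < n) (hE : Module.finrank ℂ E = n)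
    {ψ : E} (hψ : ‖ψ‖ = 1) :
    ∫ x : E, ‖inner ℂ ψ x‖ ^ 2 ∂(gaussMeasure E n) = (1 / n : ℝ) := by
  have h2 := integrable_norm_sq_gaussMeasure (E := E) hn hE
  let b := stdOrthonormalBasis ℂ E
  have hb : ∀ i, ∫ x : E, ‖inner ℂ (b i) x‖ ^ 2 ∂(gaussMeasure E n) =
      ∫ x : E, ‖inner ℂ ψ x‖ ^ 2 ∂(gaussMeasure E n) := by
    intro i
    obtain ⟨T, hT⟩ := exists_linearIsometryEquiv_apply_eq (u := b i) (v := ψ) (by simp [hψ])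
    rw [← (measurePreserving_gaussMeasure n T).integral_comp T.toHomeomorph.measurableEmbedding
      (fun x => ‖inner ℂ ψ x‖ ^ 2)]
    simp only [← hT, T.inner_map_map]
  have hi : ∀ i, Integrable (fun x => ‖inner ℂ (b i) x‖ ^ 2) (gaussMeasure E n) := fun i => by
    refine h2.mono' (by fun_prop) (ae_of_all _ fun x => ?_)
    have := norm_inner_le_norm (𝕜 := ℂ) (b i) x
    simp only [OrthonormalBasis.norm_eq_one, one_mul] at this
    rw [Real.norm_of_nonneg (by positivity)]
    gcongr
  have hs := integral_norm_sq_gaussMeasure (E := E) hn hE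
  have e : ∀ x : E, ‖x‖ ^ 2 = ∑ i, ‖inner ℂ (b i) x‖ ^ 2 :=
    fun x => (b.sum_sq_norm_inner_right x).symm
  simp_rw [e] at hs
  rw [integral_finsetSum _ (fun i _ => hi i)] at hs
  simp only [hb, Finset.sum_const, Finset.card_univ, Fintype.card_fin, hE, nsmul_eq_mul] at hs
  rw [eq_div_iff (by positivity)]
  linarith

end GaussianMeasure

section PiDensity

open MeasureTheory

/-- A finite product of measures with real densities has the product density. -/
lemma pi_withDensity_ofReal {ι X : Type*} [Fintype ι] [MeasurableSpace X] {μ : Measure X}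
    [SigmaFinite μ] {ρ : X → ℝ} (hρ : Measurable ρ) (hρ0 : ∀ x, 0 ≤ ρ x) (hi : Integrable ρ μ) :
    Measure.pi (fun _ : ι => μ.withDensity fun x => ENNReal.ofReal (ρ x)) =
      (Measure.pi fun _ : ι => μ).withDensity fun x => ENNReal.ofReal (∏ i, ρ (x i)) := by
  have : IsFiniteMeasure (μ.withDensity fun x => ENNReal.ofReal (ρ x)) :=
    isFiniteMeasure_withDensity_ofReal hi.2
  refine Measure.pi_eq fun s hs => ?_
  have hS : MeasurableSet (Set.univ.pi s) := MeasurableSet.univ_pi hs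
  rw [withDensity_apply _ hS, ← lintegral_indicator hS]
  have h1 : ∀ x : ι → X, (Set.univ.pi s).indicator
      (fun x => ENNReal.ofReal (∏ i, ρ (x i))) x =
      ENNReal.ofReal (∏ i, (s i).indicator ρ (x i)) := by
    intro x
    by_cases hx : x ∈ Set.univ.pi s
    · rw [Set.indicator_of_mem hx]
      congr 1
      exact Finset.prod_congr rfl fun i _ => (Set.indicator_of_mem (hx i (Set.mem_univ i)) _).symm
    · rw [Set.indicator_of_notMem hx]
      obtain ⟨i, hi⟩ : ∃ i, x i ∉ s i := by simpa using hx
      rw [Finset.prod_eq_zero (Finset.mem_univ i) (Set.indicator_of_notMem hi _)]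
      simp
  have h2 : ∀ i, Integrable ((s i).indicator ρ) μ := fun i => hi.indicator (hs i)
  have h3 : ∀ i x, 0 ≤ (s i).indicator ρ x := fun i x => Set.indicator_nonneg (fun y _ => hρ0 y) x
  simp_rw [h1]
  rw [← ofReal_integral_eq_lintegral_ofReal (Integrable.fintype_prod h2)
    (ae_of_all _ fun x => Finset.prod_nonneg fun i _ => h3 i _), integral_fintype_prod_eq_prod,
    ENNReal.ofReal_prod_of_nonneg fun i _ => integral_nonneg (h3 i)]
  refine Finset.prod_congr rfl fun i _ => ?_
  rw [withDensity_apply _ (hs i), ← lintegral_indicator (hs i),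
    ofReal_integral_eq_lintegral_ofReal (h2 i) (ae_of_all _ (h3 i))]
  congr 1; ext x
  by_cases hx : x ∈ s i <;> simp [hx]

variable {E : Type*} [NormedAddCommGroup E] [InnerProductSpace ℂ E] [FiniteDimensional ℂ E]
  [InnerProductSpace ℝ E] [IsScalarTower ℝ ℂ E] [FiniteDimensional ℝ E]
  [MeasurableSpace E] [BorelSpace E]

lemma lintegral_exp_neg_sum_norm_sq {ι : Type*} [Fintype ι] {n : ℕ}
    (hE : Module.finrank ℂ E = n) {c : ι → ℝ} (hc : ∀ i, 0 < c i) :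
    ∫⁻ x : ι → E, ENNReal.ofReal (Real.exp (-∑ i, c i * ‖x i‖ ^ 2)) =
      ENNReal.ofReal (∏ i, (Real.pi / c i) ^ n) := by
  have h : ∀ x : ι → E, Real.exp (-∑ i, c i * ‖x i‖ ^ 2) = ∏ i, Real.exp (-c i * ‖x i‖ ^ 2) := by
    intro x
    rw [← Real.exp_sum, ← Finset.sum_neg_distrib]
    congr 1
    exact Finset.sum_congr rfl fun i _ => by ring
  simp_rw [h]
  rw [volume_pi, ← ofReal_integral_eq_lintegral_ofReal
    (Integrable.fintype_prod fun i => integrable_exp_neg_mul_norm_sq (hc i))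
    (ae_of_all _ fun x => by positivity),
    integral_fintype_prod_eq_prod (fun i (x : E) => Real.exp (-c i * ‖x‖ ^ 2))]
  simp_rw [integral_exp_neg_mul_norm_sq hE (hc _)]

/-- Linear maps preserving `∑ ‖x i‖ ^ 2` preserve the volume. -/
lemma lintegral_comp_of_sum_norm_sq_eq {ι : Type*} [Fintype ι]
    (T : (ι → E) →ₗ[ℝ] (ι → E)) (hT : ∀ x, ∑ i, ‖T x i‖ ^ 2 = ∑ i, ‖x i‖ ^ 2)
    {f : (ι → E) → ENNReal} (hf : Measurable f) :
    ∫⁻ x, f (T x) = ∫⁻ x, f x := by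
  have hinj : Function.Injective T := by
    rw [← LinearMap.ker_eq_bot, LinearMap.ker_eq_bot']
    intro x hx
    have h := hT x
    rw [hx] at h
    simp only [Pi.zero_apply, norm_zero, ne_eq, OfNat.ofNat_ne_zero, not_false_eq_true, zero_pow,
      Finset.sum_const_zero] at h
    have := (Finset.sum_eq_zero_iff_of_nonneg (fun i _ => by positivity)).1 h.symm
    ext i
    simpa using this i (Finset.mem_univ i)
  have hdet : LinearMap.det T ≠ 0 :=
    ((LinearEquiv.ofInjectiveEndo T hinj).isUnit_det').ne_zero
  have hm : Measurable T := (LinearMap.continuous_of_finiteDimensional T).measurable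
  have key : ∀ f : (ι → E) → ENNReal, Measurable f →
      ∫⁻ x, f (T x) = ENNReal.ofReal |(LinearMap.det T)⁻¹| * ∫⁻ x, f x := by
    intro f hf
    rw [← lintegral_map hf hm, Measure.map_linearMap_addHaar_eq_smul_addHaar _ hdet,
      lintegral_smul_measure, smul_eq_mul]
  have h1 := key (fun x => ENNReal.ofReal (Real.exp (-∑ i, 1 * ‖x i‖ ^ 2))) (by fun_prop)
  simp only [one_mul, hT] at h1
  have h2 := lintegral_exp_neg_sum_norm_sq (E := E) (ι := ι) rfl (c := fun _ => 1) (by simp)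
  simp only [one_mul] at h2
  have h3 : ENNReal.ofReal |(LinearMap.det T)⁻¹| = 1 := by
    refine (ENNReal.mul_left_inj (c := ∫⁻ x : ι → E, ENNReal.ofReal
      (Real.exp (-∑ i, ‖x i‖ ^ 2))) ?_ ?_).1 ?_
    · rw [h2]; simp; positivity
    · rw [h2]; simp
    · rw [one_mul, ← h1]
  rw [key f hf, h3, one_mul]

end PiDensity

section QuadraticForm

variable {ι E : Type*} [Fintype ι] [NormedAddCommGroup E] [InnerProductSpace ℂ E]

/-- The real quadratic form `Re ∑ a i j ⟪x i, x j⟫` on families of vectors. -/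
noncomputable def quadForm (a : Matrix ι ι ℂ) (x : ι → E) : ℝ :=
  ∑ i, ∑ j, (a i j * inner ℂ (x i) (x j)).re

/-- The family `∑ j, conj (V j k) • x j`. -/
noncomputable def mixVectors (V : Matrix ι ι ℂ) : (ι → E) →ₗ[ℂ] (ι → E) where
  toFun x k := ∑ j, star (V j k) • x j
  map_add' x y := by ext k; simp [Finset.sum_add_distrib]
  map_smul' c x := by
    ext k
    simp only [Pi.smul_apply, RingHom.id_apply, Finset.smul_sum]
    exact Finset.sum_congr rfl fun j _ => smul_comm _ _ _

lemma sum_mul_norm_mixVectors_sq (V : Matrix ι ι ℂ) (c : ι → ℝ) (x : ι → E) :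
    ((∑ k, c k * ‖mixVectors V x k‖ ^ 2 : ℝ) : ℂ) =
      ∑ i, ∑ j, (∑ k, V i k * c k * star (V j k)) * inner ℂ (x i) (x j) := by
  have h : ∀ k, (‖mixVectors V x k‖ ^ 2 : ℂ) =
      ∑ i, ∑ j, V i k * star (V j k) * inner ℂ (x i) (x j) := by
    intro k
    refine (inner_self_eq_norm_sq_to_K (𝕜 := ℂ) (mixVectors V x k)).symm.trans ?_
    simp only [mixVectors, LinearMap.coe_mk, AddHom.coe_mk, sum_inner, inner_sum,
      inner_smul_left, inner_smul_right, RCLike.star_def, Complex.conj_conj]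
    simp only [Finset.mul_sum]
    rw [Finset.sum_comm]
    exact Finset.sum_congr rfl fun i _ => Finset.sum_congr rfl fun j _ => by ring
  push_cast
  simp_rw [h, Finset.mul_sum, Finset.sum_mul]
  rw [Finset.sum_comm]
  refine Finset.sum_congr rfl fun i _ => ?_
  rw [Finset.sum_comm]
  exact Finset.sum_congr rfl fun j _ => Finset.sum_congr rfl fun k _ => by ring

lemma quadForm_hermitianPart (a : Matrix ι ι ℂ) (x : ι → E) :
    quadForm ((1 / 2 : ℂ) • (a + aᴴ)) x = quadForm a x := by
  have h : quadForm aᴴ x = quadForm a x := by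
    unfold quadForm
    rw [Finset.sum_comm]
    refine Finset.sum_congr rfl fun i _ => Finset.sum_congr rfl fun j _ => ?_
    rw [conjTranspose_apply, ← inner_conj_symm (x j) (x i), RCLike.star_def, ← map_mul,
      Complex.conj_re]
  have h2 : quadForm ((1 / 2 : ℂ) • (a + aᴴ)) x = (1 / 2) * (quadForm a x + quadForm aᴴ x) := by
    unfold quadForm
    simp only [← Finset.sum_add_distrib, Finset.mul_sum]
    refine Finset.sum_congr rfl fun i _ => Finset.sum_congr rfl fun j _ => ?_
    rw [Matrix.smul_apply, Matrix.add_apply, smul_eq_mul, mul_assoc, add_mul,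
      show (1 / 2 : ℂ) = ((1 / 2 : ℝ) : ℂ) by push_cast; rfl, Complex.re_ofReal_mul,
      Complex.add_re]
  rw [h2, h]; ring

lemma sum_norm_hermitianPart_sq_le (a : Matrix ι ι ℂ) :
    ∑ i, ∑ j, ‖((1 / 2 : ℂ) • (a + aᴴ)) i j‖ ^ 2 ≤ ∑ i, ∑ j, ‖a i j‖ ^ 2 := by
  have h : ∀ i j, ‖((1 / 2 : ℂ) • (a + aᴴ)) i j‖ ^ 2 ≤ (‖a i j‖ ^ 2 + ‖a j i‖ ^ 2) / 2 := by
    intro i j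
    have h1 : ‖a i j + star (a j i)‖ ≤ ‖a i j‖ + ‖a j i‖ := by
      simpa using norm_add_le (a i j) (star (a j i))
    rw [Matrix.smul_apply, Matrix.add_apply, conjTranspose_apply, norm_smul]
    have h2 : ‖(1 / 2 : ℂ)‖ = 1 / 2 := by norm_num
    rw [h2]
    nlinarith [norm_nonneg (a i j + star (a j i)), sq_nonneg (‖a i j‖ - ‖a j i‖),
      norm_nonneg (a i j), norm_nonneg (a j i)]
  calc _ ≤ ∑ i, ∑ j, (‖a i j‖ ^ 2 + ‖a j i‖ ^ 2) / 2 :=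
        Finset.sum_le_sum fun i _ => Finset.sum_le_sum fun j _ => h i j
    _ = ∑ i, ∑ j, ‖a i j‖ ^ 2 := by
        simp_rw [add_div, Finset.sum_add_distrib]
        rw [Finset.sum_comm (f := fun i j => ‖a j i‖ ^ 2 / 2), ← Finset.sum_add_distrib]
        refine Finset.sum_congr rfl fun i _ => ?_
        rw [← Finset.sum_add_distrib]
        exact Finset.sum_congr rfl fun j _ => by ring

variable [DecidableEq ι]

lemma sum_norm_mixVectors_sq (V : Matrix.unitaryGroup ι ℂ) (x : ι → E) :
    ∑ k, ‖mixVectors (V : Matrix ι ι ℂ) x k‖ ^ 2 = ∑ k, ‖x k‖ ^ 2 := by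
  have h := sum_mul_norm_mixVectors_sq (V : Matrix ι ι ℂ) (fun _ => 1) x
  have hV : ∀ i j, ∑ k, (V : Matrix ι ι ℂ) i k * ((1 : ℝ) : ℂ) * star ((V : Matrix ι ι ℂ) j k) =
      (1 : Matrix ι ι ℂ) i j := by
    intro i j
    have := Matrix.mem_unitaryGroup_iff.1 V.2
    rw [← this, mul_apply]
    simp [star_apply]
  simp_rw [hV] at h
  simp only [one_mul, one_apply, ite_mul, zero_mul, Finset.sum_ite_eq, Finset.mem_univ,
    if_true] at h
  have h2 : ∑ k, inner ℂ (x k) (x k) = ((∑ k, ‖x k‖ ^ 2 : ℝ) : ℂ) := by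
    push_cast
    exact Finset.sum_congr rfl fun k _ => inner_self_eq_norm_sq_to_K _
  exact Complex.ofReal_injective (h.trans h2)

lemma Matrix.IsHermitian.apply_eq_sum {b : Matrix ι ι ℂ} (hb : b.IsHermitian) (i j : ι) :
    b i j = ∑ k, (hb.eigenvectorUnitary : Matrix ι ι ℂ) i k * hb.eigenvalues k *
      star ((hb.eigenvectorUnitary : Matrix ι ι ℂ) j k) := by
  conv_lhs => rw [hb.spectral_theorem]
  simp [Unitary.conjStarAlgAut_apply, mul_apply, star_apply, diagonal_apply]

lemma quadForm_eq_sum_eigenvalues {b : Matrix ι ι ℂ} (hb : b.IsHermitian) (x : ι → E) :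
    quadForm b x = ∑ k, hb.eigenvalues k *
      ‖mixVectors (hb.eigenvectorUnitary : Matrix ι ι ℂ) x k‖ ^ 2 := by
  have h := congrArg Complex.re (sum_mul_norm_mixVectors_sq
    (hb.eigenvectorUnitary : Matrix ι ι ℂ) hb.eigenvalues x)
  rw [Complex.ofReal_re] at h
  rw [h, Complex.re_sum]
  unfold quadForm
  refine Finset.sum_congr rfl fun i _ => ?_
  rw [Complex.re_sum]
  exact Finset.sum_congr rfl fun j _ => by rw [hb.apply_eq_sum i j]

lemma Matrix.IsHermitian.sum_eigenvalues_sq {b : Matrix ι ι ℂ} (hb : b.IsHermitian) :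
    ∑ k, hb.eigenvalues k ^ 2 = ∑ i, ∑ j, ‖b i j‖ ^ 2 := by
  have h1 : (b * b).trace = ((∑ i, ∑ j, ‖b i j‖ ^ 2 : ℝ) : ℂ) := by
    rw [trace]
    push_cast
    refine Finset.sum_congr rfl fun i _ => ?_
    rw [diag_apply, mul_apply]
    refine Finset.sum_congr rfl fun j _ => ?_
    rw [← hb.apply i j, RCLike.star_def, ← Complex.normSq_eq_conj_mul_self,
      Complex.normSq_eq_norm_sq, RCLike.norm_conj]
    push_cast; rfl
  have h2 : (b * b).trace = ((∑ k, hb.eigenvalues k ^ 2 : ℝ) : ℂ) := by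
    conv_lhs => rw [hb.spectral_theorem]
    rw [← map_mul, Unitary.conjStarAlgAut_apply, trace_mul_comm, ← mul_assoc,
      Unitary.coe_star_mul_self, one_mul, diagonal_mul_diagonal, trace_diagonal]
    simp [pow_two]
  exact_mod_cast h2.symm.trans h1

end QuadraticForm

section MomentGenerating

open MeasureTheory

lemma sum_neg_log_one_sub_le {ι : Type*} [Fintype ι] {τ : ℝ} (hτ : 0 < τ) (hτ1 : τ < 1)
    {β : ι → ℝ} (h0 : ∑ k, β k = 0) (h1 : ∑ k, β k ^ 2 ≤ 1) :
    (∀ k, 0 < 1 - τ * β k) ∧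
      ∑ k, -Real.log (1 - τ * β k) ≤ -Real.log (1 - τ) - τ := by
  have hβ : ∀ k, |β k| ≤ 1 := fun k => by
    rw [← sq_le_one_iff_abs_le_one]
    exact (Finset.single_le_sum (f := fun k => β k ^ 2) (fun i _ => sq_nonneg _)
      (Finset.mem_univ k)).trans h1
  have hτβ : ∀ k, |τ * β k| ≤ τ := fun k => by
    rw [abs_mul, abs_of_pos hτ]
    exact mul_le_of_le_one_right hτ.le (hβ k)
  have hc : 0 ≤ -Real.log (1 - τ) - τ := by
    have := Real.log_le_sub_one_of_pos (show 0 < 1 - τ by linarith)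
    linarith
  refine ⟨fun k => by linarith [(abs_le.1 (hτβ k)).2], ?_⟩
  calc ∑ k, -Real.log (1 - τ * β k)
      ≤ ∑ k, (τ * β k + (τ * β k / τ) ^ 2 * (-Real.log (1 - τ) - τ)) :=
        Finset.sum_le_sum fun k _ => neg_log_one_sub_le hτ hτ1 (hτβ k)
    _ = τ * ∑ k, β k + (∑ k, β k ^ 2) * (-Real.log (1 - τ) - τ) := by
        rw [Finset.sum_add_distrib, Finset.mul_sum, Finset.sum_mul]
        congr 1
        exact Finset.sum_congr rfl fun k _ => by field_simp
    _ ≤ -Real.log (1 - τ) - τ := by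
        rw [h0, mul_zero, zero_add]
        exact mul_le_of_le_one_left hc h1

variable {E : Type*} [NormedAddCommGroup E] [InnerProductSpace ℂ E] [FiniteDimensional ℂ E]
  [InnerProductSpace ℝ E] [IsScalarTower ℝ ℂ E] [FiniteDimensional ℝ E]
  [MeasurableSpace E] [BorelSpace E] {ι : Type*} [Fintype ι]

lemma continuous_quadForm (a : Matrix ι ι ℂ) : Continuous (quadForm a : (ι → E) → ℝ) := by
  unfold quadForm
  refine continuous_finsetSum _ fun i _ => continuous_finsetSum _ fun j _ => ?_
  exact Complex.continuous_re.comp (continuous_const.mul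
    ((continuous_apply i).inner (continuous_apply j)))

lemma lintegral_exp_quadForm_le [DecidableEq ι] {n : ℕ} (hn : 0 < n)
    (hE : Module.finrank ℂ E = n) {τ : ℝ} (hτ : 0 < τ) (hτ1 : τ < 1) {a : Matrix ι ι ℂ}
    (hdiag : ∀ i, a i i = 0) (ha : ∑ i, ∑ j, ‖a i j‖ ^ 2 ≤ 1) :
    ∫⁻ x : ι → E, ENNReal.ofReal (Real.exp (n * τ * quadForm a x))
        ∂(Measure.pi fun _ : ι => gaussMeasure E n) ≤
      ENNReal.ofReal (Real.exp (n * (-Real.log (1 - τ) - τ))) := by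
  have hn0 : (0 : ℝ) < n := by positivity
  set b : Matrix ι ι ℂ := (1 / 2 : ℂ) • (a + aᴴ) with hb_def
  have hb : b.IsHermitian := by
    rw [hb_def, IsHermitian, conjTranspose_smul, conjTranspose_add, conjTranspose_conjTranspose,
      add_comm]
    simp
  obtain ⟨hpos, hlog⟩ := sum_neg_log_one_sub_le hτ hτ1 (β := hb.eigenvalues) (by
      have h := hb.trace_eq_sum_eigenvalues
      have h0 : b.trace = 0 := by
        simp [trace, hb_def, hdiag]
      rw [h0] at h
      apply Complex.ofReal_injective
      rw [Complex.ofReal_sum]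
      exact h.symm)
    (by
      rw [hb.sum_eigenvalues_sq]
      exact (sum_norm_hermitianPart_sq_le a).trans ha)
  set β := hb.eigenvalues
  let T := (mixVectors (E := E) (hb.eigenvectorUnitary : Matrix ι ι ℂ)).restrictScalars ℝ
  have hTn : ∀ x, ∑ i, ‖T x i‖ ^ 2 = ∑ i, ‖x i‖ ^ 2 := sum_norm_mixVectors_sq _
  have hq : Measurable (quadForm a : (ι → E) → ℝ) := (continuous_quadForm a).measurable
  unfold gaussMeasure
  rw [pi_withDensity_ofReal (continuous_gaussDensity n).measurable (gaussDensity_nonneg n)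
    (integrable_gaussDensity hn), lintegral_withDensity_eq_lintegral_mul _
      (by unfold gaussDensity; fun_prop) (by fun_prop)]
  have e : ∀ x : ι → E, ((fun x : ι → E => ENNReal.ofReal (∏ i, gaussDensity n (x i))) *
      (fun x => ENNReal.ofReal (Real.exp (n * τ * quadForm a x))) : (ι → E) → ENNReal) x =
      ENNReal.ofReal (((n / Real.pi) ^ n) ^ Fintype.card ι) *
        ENNReal.ofReal (Real.exp (-∑ k, n * (1 - τ * β k) * ‖T x k‖ ^ 2)) := by
    intro x
    rw [Pi.mul_apply, ← ENNReal.ofReal_mul (Finset.prod_nonneg fun i _ => gaussDensity_nonneg _ _),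
      ← ENNReal.ofReal_mul (by positivity)]
    unfold gaussDensity
    rw [Finset.prod_mul_distrib, Finset.prod_const, Finset.card_univ, ← Real.exp_sum, mul_assoc,
      ← Real.exp_add, ← quadForm_hermitianPart, quadForm_eq_sum_eigenvalues hb,
      ← Finset.mul_sum, ← hTn]
    congr 3
    rw [Finset.mul_sum, Finset.mul_sum, ← Finset.sum_add_distrib, ← Finset.sum_neg_distrib]
    refine Finset.sum_congr rfl fun k _ => ?_
    change -n * ‖T x k‖ ^ 2 + n * τ * (β k * ‖T x k‖ ^ 2) = _
    ring
  rw [lintegral_congr e, lintegral_const_mul' _ _ ENNReal.ofReal_ne_top]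
  change _ * ∫⁻ x : ι → E, _ ≤ _
  rw [lintegral_comp_of_sum_norm_sq_eq T hTn (f := fun y => ENNReal.ofReal
      (Real.exp (-∑ k, n * (1 - τ * β k) * ‖y k‖ ^ 2))) (by fun_prop),
    lintegral_exp_neg_sum_norm_sq hE (fun k => mul_pos hn0 (hpos k)),
    ← ENNReal.ofReal_mul (by positivity)]
  refine ENNReal.ofReal_le_ofReal ?_
  rw [← Finset.card_univ, ← Finset.prod_const, ← Finset.prod_mul_distrib]
  have e2 : ∀ k, ((n : ℝ) / Real.pi) ^ n * (Real.pi / (n * (1 - τ * β k))) ^ n =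
      Real.exp (n * -Real.log (1 - τ * β k)) := by
    intro k
    have := hpos k
    rw [← mul_pow, Real.exp_nat_mul, Real.exp_neg, Real.exp_log this]
    congr 1
    field_simp
  simp_rw [e2]
  rw [← Real.exp_sum, ← Finset.mul_sum]
  gcongr

end MomentGenerating

section RandomUnitaries

open MeasureTheory

variable {E : Type*} [NormedAddCommGroup E] [InnerProductSpace ℂ E] [FiniteDimensional ℂ E]
  [InnerProductSpace ℝ E] [IsScalarTower ℝ ℂ E] [FiniteDimensional ℝ E]
  [MeasurableSpace E] [BorelSpace E] {ι : Type*}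

lemma compactSpace_unitary (E : Type*) [NormedAddCommGroup E] [InnerProductSpace ℂ E]
    [FiniteDimensional ℂ E] : CompactSpace (unitary (E →L[ℂ] E)) := by
  have : ProperSpace (E →L[ℂ] E) := FiniteDimensional.proper ℂ _
  refine isCompact_iff_compactSpace.1 (Metric.isCompact_of_isClosed_isBounded isClosed_unitary ?_)
  refine (Metric.isBounded_closedBall (x := (0 : E →L[ℂ] E)) (r := 1)).subset fun u hu => ?_
  rw [mem_closedBall_zero_iff]
  exact ContinuousLinearMap.opNorm_le_bound _ zero_le_one fun x => by
    rw [one_mul]; exact (Unitary.norm_map ⟨u, hu⟩ x).le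

/-- Coordinatewise action of the inverses of a family of unitaries. -/
noncomputable def invAct (U : ι → unitary (E →L[ℂ] E)) (x : ι → E) : ι → E :=
  fun i => (((U i)⁻¹ : unitary (E →L[ℂ] E)) : E →L[ℂ] E) (x i)

lemma continuous_invAct :
    Continuous fun p : (ι → unitary (E →L[ℂ] E)) × (ι → E) => invAct p.1 p.2 := by
  unfold invAct
  refine continuous_pi fun i => ?_
  refine Continuous.clm_apply (continuous_subtype_val.comp ?_) (by fun_prop)
  exact ((continuous_apply i).comp continuous_fst).inv

lemma invAct_smul (U : ι → unitary (E →L[ℂ] E)) (r : ι → ℝ) (x : ι → E) :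
    invAct U (fun i => r i • x i) = fun i => r i • invAct U x i := by
  ext i
  unfold invAct
  beta_reduce
  rw [← algebraMap_smul ℂ (r i) (x i), map_smul, algebraMap_smul]

variable [Fintype ι]

lemma quadForm_smul (a : Matrix ι ι ℂ) (r : ι → ℝ) (x : ι → E) :
    quadForm a (fun i => r i • x i) =
      ∑ i, ∑ j, r i * r j * (a i j * inner ℂ (x i) (x j)).re := by
  unfold quadForm
  refine Finset.sum_congr rfl fun i _ => Finset.sum_congr rfl fun j _ => ?_
  beta_reduce
  rw [← algebraMap_smul ℂ (r i) (x i), ← algebraMap_smul ℂ (r j) (x j), inner_smul_left,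
    inner_smul_right, Complex.coe_algebraMap, Complex.conj_ofReal, ← Complex.re_ofReal_mul]
  congr 1
  push_cast; ring

lemma integrable_norm_gaussMeasure {n : ℕ} (hn : 0 < n) (hE : Module.finrank ℂ E = n) :
    Integrable (fun x : E => ‖x‖) (gaussMeasure E n) := by
  have := isProbabilityMeasure_gaussMeasure hn hE
  refine ((integrable_norm_sq_gaussMeasure (E := E) hn hE).add (integrable_const 1)).mono'
    (by fun_prop) (ae_of_all _ fun x => ?_)
  simp only [norm_norm, Pi.add_apply]
  nlinarith [sq_nonneg (‖x‖ - 1), norm_nonneg x]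

lemma integrable_norm_mul_norm_pi [DecidableEq ι] {n : ℕ} (hn : 0 < n)
    (hE : Module.finrank ℂ E = n) {i j : ι} (hij : i ≠ j) :
    Integrable (fun x : ι → E => ‖x i‖ * ‖x j‖) (Measure.pi fun _ => gaussMeasure E n) ∧
      ∫ x : ι → E, ‖x i‖ * ‖x j‖ ∂(Measure.pi fun _ => gaussMeasure E n) =
        (∫ x : E, ‖x‖ ∂(gaussMeasure E n)) ^ 2 := by
  have := isProbabilityMeasure_gaussMeasure (E := E) hn hE
  let f : ι → E → ℝ := fun k x => (if k = i then ‖x‖ else 1) * (if k = j then ‖x‖ else 1)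
  have hf : ∀ x : ι → E, ‖x i‖ * ‖x j‖ = ∏ k, f k (x k) := fun x => by
    simp only [f, Finset.prod_mul_distrib, Finset.prod_ite_eq', Finset.mem_univ, if_true]
  have hint : ∀ k, ∫ x : E, f k x ∂(gaussMeasure E n) =
      (if k = i then ∫ x : E, ‖x‖ ∂(gaussMeasure E n) else 1) *
        (if k = j then ∫ x : E, ‖x‖ ∂(gaussMeasure E n) else 1) := by
    intro k
    by_cases hi : k = i
    · have hj : k ≠ j := hi ▸ hij
      simp [f, hi, hij]
    · by_cases hj : k = j <;> simp [f, hi, hj, hij.symm]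
  have hfi : ∀ k, Integrable (f k) (gaussMeasure E n) := by
    intro k
    have h1 := integrable_norm_gaussMeasure (E := E) hn hE
    by_cases hi : k = i
    · have hj : k ≠ j := hi ▸ hij
      simpa [f, hi, hij] using h1
    · by_cases hj : k = j
      · simpa [f, hj, hij.symm] using h1
      · simp [f, hi, hj]
  simp_rw [hf]
  refine ⟨Integrable.fintype_prod hfi, ?_⟩
  rw [integral_fintype_prod_eq_prod, Finset.prod_congr rfl fun k _ => hint k,
    Finset.prod_mul_distrib]
  simp [pow_two]

lemma integral_quadForm_norm_smul [DecidableEq ι] {n : ℕ} (hn : 0 < n)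
    (hE : Module.finrank ℂ E = n) {a : Matrix ι ι ℂ} (hdiag : ∀ i, a i i = 0) (v : ι → E) :
    Integrable (fun x : ι → E => quadForm a fun i => ‖x i‖ • v i)
        (Measure.pi fun _ => gaussMeasure E n) ∧
      ∫ x : ι → E, quadForm a (fun i => ‖x i‖ • v i) ∂(Measure.pi fun _ => gaussMeasure E n) =
        (∫ x : E, ‖x‖ ∂(gaussMeasure E n)) ^ 2 * quadForm a v := by
  have h : ∀ i j, Integrable (fun x : ι → E => ‖x i‖ * ‖x j‖ * (a i j * inner ℂ (v i) (v j)).re)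
        (Measure.pi fun _ => gaussMeasure E n) ∧
      ∫ x : ι → E, ‖x i‖ * ‖x j‖ * (a i j * inner ℂ (v i) (v j)).re
        ∂(Measure.pi fun _ => gaussMeasure E n) =
        (∫ x : E, ‖x‖ ∂(gaussMeasure E n)) ^ 2 * (a i j * inner ℂ (v i) (v j)).re := by
    intro i j
    by_cases hij : i = j
    · subst hij; simp [hdiag]
    · obtain ⟨h1, h2⟩ := integrable_norm_mul_norm_pi (E := E) hn hE hij
      exact ⟨h1.mul_const _, by rw [integral_mul_const, h2]⟩
  simp_rw [quadForm_smul a _ v]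
  refine ⟨integrable_finsetSum _ fun i _ => integrable_finsetSum _ fun j _ => (h i j).1, ?_⟩
  rw [integral_finsetSum _ fun i _ => integrable_finsetSum _ fun j _ => (h i j).1]
  simp_rw [integral_finsetSum _ fun j _ => (h _ j).1, (h _ _).2]
  simp only [quadForm, Finset.mul_sum]

lemma lintegral_exp_quadForm_invAct_le [DecidableEq ι] {n : ℕ} (hn : 0 < n)
    (hE : Module.finrank ℂ E = n) {τ : ℝ} (hτ : 0 < τ) (hτ1 : τ < 1) {a : Matrix ι ι ℂ}
    (hdiag : ∀ i, a i i = 0) (ha : ∑ i, ∑ j, ‖a i j‖ ^ 2 ≤ 1) {φ : E} (hφ : ‖φ‖ = 1)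
    (μ : Measure (ι → unitary (E →L[ℂ] E))) [IsProbabilityMeasure μ] [μ.IsMulLeftInvariant] :
    ∫⁻ U, ENNReal.ofReal (Real.exp (n * (τ * (∫ x : E, ‖x‖ ∂(gaussMeasure E n)) ^ 2) *
        quadForm a (invAct U fun _ => φ))) ∂μ ≤
      ENNReal.ofReal (Real.exp (n * (-Real.log (1 - τ) - τ))) := by
  have := isProbabilityMeasure_gaussMeasure (E := E) hn hE
  set ρ := ∫ x : E, ‖x‖ ∂(gaussMeasure E n)
  let γ : Measure (ι → E) := Measure.pi fun _ => gaussMeasure E n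
  have hcont : Continuous fun p : (ι → unitary (E →L[ℂ] E)) × (ι → E) =>
      ENNReal.ofReal (Real.exp (n * τ * quadForm a (invAct p.1 p.2))) :=
    ENNReal.continuous_ofReal.comp (Real.continuous_exp.comp
      (continuous_const.mul ((continuous_quadForm a).comp continuous_invAct)))
  have hcont2 : Continuous fun p : (ι → unitary (E →L[ℂ] E)) × (ι → E) =>
      ENNReal.ofReal (Real.exp (n * τ * quadForm a (invAct p.1 fun i => ‖p.2 i‖ • φ))) :=
    hcont.comp (f := fun p : (ι → unitary (E →L[ℂ] E)) × (ι → E) => (p.1, fun i => ‖p.2 i‖ • φ))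
      (by fun_prop)
  have hJ : ∀ U : ι → unitary (E →L[ℂ] E),
      ENNReal.ofReal (Real.exp (n * (τ * ρ ^ 2) * quadForm a (invAct U fun _ => φ))) ≤
        ∫⁻ x, ENNReal.ofReal (Real.exp (n * τ * quadForm a (invAct U fun i => ‖x i‖ • φ))) ∂γ := by
    intro U
    obtain ⟨h1, h2⟩ := integral_quadForm_norm_smul (E := E) hn hE hdiag (invAct U fun _ => φ)
    have h3 := ofReal_exp_integral_le_lintegral (h1.const_mul (n * τ))
    rw [integral_const_mul, h2] at h3
    simp_rw [invAct_smul U _ (fun _ => φ)]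
    refine le_trans (le_of_eq ?_) h3
    congr 2
    ring
  have hinv : ∀ x : ι → E,
      ∫⁻ U, ENNReal.ofReal (Real.exp (n * τ * quadForm a (invAct U fun i => ‖x i‖ • φ))) ∂μ =
        ∫⁻ U, ENNReal.ofReal (Real.exp (n * τ * quadForm a (invAct U x))) ∂μ := by
    intro x
    have hW : ∀ i, ∃ T : E ≃ₗᵢ[ℂ] E, T (x i) = ‖x i‖ • φ := fun i =>
      exists_linearIsometryEquiv_apply_eq (by rw [norm_smul, hφ]; simp)
    choose T hT using hW
    rw [← lintegral_mul_left_eq_self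
      (fun U => ENNReal.ofReal (Real.exp (n * τ * quadForm a (invAct U fun i => ‖x i‖ • φ))))
      (fun i => Unitary.linearIsometryEquiv.symm (T i))]
    congr 1; ext U; congr 4
    ext i
    unfold invAct
    rw [Pi.mul_apply, _root_.mul_inv_rev, Submonoid.coe_mul, mul_apply_eq_comp, ← map_inv,
      Unitary.coe_symm_linearIsometryEquiv_apply]
    beta_reduce
    rw [← hT i]
    congr 1
    exact (T i).symm_apply_apply (x i)
  have hpres : ∀ U : ι → unitary (E →L[ℂ] E), MeasurePreserving (invAct U) γ γ := fun U =>
    measurePreserving_pi _ _ fun i =>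
      measurePreserving_gaussMeasure n (Unitary.linearIsometryEquiv (U i)⁻¹)
  have hq : Measurable (quadForm a : (ι → E) → ℝ) := (continuous_quadForm a).measurable
  calc _ ≤ ∫⁻ U, ∫⁻ x, ENNReal.ofReal (Real.exp (n * τ *
          quadForm a (invAct U fun i => ‖x i‖ • φ))) ∂γ ∂μ := lintegral_mono hJ
    _ = ∫⁻ x, ∫⁻ U, ENNReal.ofReal (Real.exp (n * τ *
          quadForm a (invAct U fun i => ‖x i‖ • φ))) ∂μ ∂γ :=
        lintegral_lintegral_swap hcont2.measurable.aemeasurable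
    _ = ∫⁻ x, ∫⁻ U, ENNReal.ofReal (Real.exp (n * τ * quadForm a (invAct U x))) ∂μ ∂γ :=
        lintegral_congr hinv
    _ = ∫⁻ U, ∫⁻ x, ENNReal.ofReal (Real.exp (n * τ * quadForm a (invAct U x))) ∂γ ∂μ :=
        (lintegral_lintegral_swap hcont.measurable.aemeasurable).symm
    _ = ∫⁻ _, ∫⁻ x, ENNReal.ofReal (Real.exp (n * τ * quadForm a x)) ∂γ ∂μ := by
        refine lintegral_congr fun U => ?_
        exact (hpres U).lintegral_comp (f := fun x => ENNReal.ofReal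
          (Real.exp (n * τ * quadForm a x))) (by fun_prop)
    _ = ∫⁻ x, ENNReal.ofReal (Real.exp (n * τ * quadForm a x)) ∂γ := by simp
    _ ≤ _ := lintegral_exp_quadForm_le hn hE hτ hτ1 hdiag ha

/-- A single family of unitaries works for finitely many quadratic forms. -/
lemma exists_unitaries_lintegral_exp_le [DecidableEq ι] {n : ℕ} (hn : 0 < n)
    (hE : Module.finrank ℂ E = n) {τ : ℝ} (hτ : 0 < τ) (hτ1 : τ < 1)
    (S : Finset (Matrix ι ι ℂ)) (hdiag : ∀ a ∈ S, ∀ i, a i i = 0)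
    (hS : ∀ a ∈ S, ∑ i, ∑ j, ‖a i j‖ ^ 2 ≤ 1) :
    ∃ V : ι → E ≃ₗᵢ[ℂ] E, ∀ a ∈ S,
      ∫⁻ g : E, ENNReal.ofReal (Real.exp (n * (τ * (∫ x : E, ‖x‖ ∂(gaussMeasure E n)) ^ 2) *
        quadForm a (fun i => V i (‖g‖⁻¹ • g)))) ∂(gaussMeasure E n) ≤
      S.card * ENNReal.ofReal (Real.exp (n * (-Real.log (1 - τ) - τ))) := by
  have := isProbabilityMeasure_gaussMeasure (E := E) hn hE
  have := compactSpace_unitary E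
  set ρ := ∫ x : E, ‖x‖ ∂(gaussMeasure E n)
  let K : TopologicalSpace.PositiveCompacts (ι → unitary (E →L[ℂ] E)) := ⊤
  let μ := Measure.haarMeasure K
  have hμ : IsProbabilityMeasure μ := ⟨by
    have := Measure.haarMeasure_self (K₀ := K)
    rwa [show (K : Set (ι → unitary (E →L[ℂ] E))) = Set.univ from rfl] at this⟩
  have hmeas : ∀ a : Matrix ι ι ℂ, Measurable fun p : (ι → unitary (E →L[ℂ] E)) × E =>
      ENNReal.ofReal (Real.exp (n * (τ * ρ ^ 2) *
        quadForm a (invAct p.1 fun _ => ‖p.2‖⁻¹ • p.2))) := by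
    intro a
    have h : Measurable fun p : (ι → unitary (E →L[ℂ] E)) × E =>
        quadForm a (invAct p.1 fun _ => ‖p.2‖⁻¹ • p.2) :=
      ((continuous_quadForm a).comp continuous_invAct).measurable.comp
        (g := fun p : (ι → unitary (E →L[ℂ] E)) × (ι → E) => quadForm a (invAct p.1 p.2))
        (f := fun p : (ι → unitary (E →L[ℂ] E)) × E =>
        (p.1, fun _ => ‖p.2‖⁻¹ • p.2)) (by fun_prop)
    fun_prop
  have hZ : ∀ a ∈ S, ∫⁻ U, ∫⁻ g : E, ENNReal.ofReal (Real.exp (n * (τ * ρ ^ 2) *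
        quadForm a (invAct U fun _ => ‖g‖⁻¹ • g))) ∂(gaussMeasure E n) ∂μ ≤
      ENNReal.ofReal (Real.exp (n * (-Real.log (1 - τ) - τ))) := by
    intro a ha
    rw [lintegral_lintegral_swap (hmeas a).aemeasurable]
    refine (lintegral_mono (g := fun _ => ENNReal.ofReal
      (Real.exp (n * (-Real.log (1 - τ) - τ)))) fun g => ?_).trans (by simp)
    by_cases hg : g = 0
    · have h0 : 0 ≤ -Real.log (1 - τ) - τ := by
        have := Real.log_le_sub_one_of_pos (show 0 < 1 - τ by linarith)
        linarith
      have : ∀ U : ι → unitary (E →L[ℂ] E), quadForm a (invAct U fun _ => ‖g‖⁻¹ • g) = 0 :=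
        fun U => by simp [hg, invAct, quadForm]
      simp only [this, mul_zero, Real.exp_zero, ENNReal.ofReal_one, lintegral_const,
        measure_univ, mul_one]
      rw [← ENNReal.ofReal_one]
      exact ENNReal.ofReal_le_ofReal (Real.one_le_exp (by positivity))
    · exact lintegral_exp_quadForm_invAct_le hn hE hτ hτ1 (hdiag a ha) (hS a ha)
        (by rw [norm_smul, norm_inv, norm_norm, inv_mul_cancel₀ (norm_ne_zero_iff.2 hg)]) μ
  obtain ⟨U, hU⟩ := exists_le_lintegral (μ := μ) (f := fun U => ∑ a ∈ S,
    ∫⁻ g : E, ENNReal.ofReal (Real.exp (n * (τ * ρ ^ 2) *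
        quadForm a (invAct U fun _ => ‖g‖⁻¹ • g))) ∂(gaussMeasure E n))
    (Finset.measurable_sum _ fun a _ => (hmeas a).lintegral_prod_right').aemeasurable
  rw [lintegral_finsetSum _ fun a _ => (hmeas a).lintegral_prod_right'] at hU
  refine ⟨fun i => Unitary.linearIsometryEquiv (U i)⁻¹, fun a ha => ?_⟩
  refine (Finset.single_le_sum (f := fun a => ∫⁻ g : E, ENNReal.ofReal
    (Real.exp (n * (τ * ρ ^ 2) * quadForm a (invAct U fun _ => ‖g‖⁻¹ • g)))
    ∂(gaussMeasure E n)) (fun _ _ => zero_le) ha).trans (hU.trans ?_)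
  refine (Finset.sum_le_sum hZ).trans ?_
  rw [Finset.sum_const, nsmul_eq_mul]

end RandomUnitaries

section QuadraticLowerBound

open MeasureTheory

variable {E : Type*} [NormedAddCommGroup E] [InnerProductSpace ℂ E] [FiniteDimensional ℂ E]
  [InnerProductSpace ℝ E] [IsScalarTower ℝ ℂ E] [FiniteDimensional ℝ E]
  [MeasurableSpace E] [BorelSpace E]

lemma abs_real_inner_le_norm_inner {E : Type*} [NormedAddCommGroup E] [InnerProductSpace ℂ E]
    [InnerProductSpace ℝ E] (x y : E) : |inner ℝ x y| ≤ ‖inner ℂ x y‖ := by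
  have h1 := real_inner_eq_norm_add_mul_self_sub_norm_mul_self_sub_norm_mul_self_div_two x y
  have h2 := re_inner_eq_norm_add_mul_self_sub_norm_mul_self_sub_norm_mul_self_div_two
    (𝕜 := ℂ) x y
  rw [h1, ← h2]
  exact Complex.abs_re_le_norm _

lemma integral_abs_le_of_integral_sq {α : Type*} [MeasurableSpace α] {μ : Measure α}
    [IsProbabilityMeasure μ] {X : α → ℝ} (hX : AEStronglyMeasurable X μ)
    (hX2 : Integrable (fun x => X x ^ 2) μ) {s : ℝ} (hs : 0 < s)
    (h : ∫ x, X x ^ 2 ∂μ ≤ s ^ 2) : Integrable X μ ∧ ∫ x, |X x| ∂μ ≤ s := by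
  have hb : ∀ x, |X x| ≤ (2 * s)⁻¹ * X x ^ 2 + s / 2 := fun x => by
    have e : (2 * s)⁻¹ * X x ^ 2 + s / 2 - |X x| = (2 * s)⁻¹ * (|X x| - s) ^ 2 := by
      rw [← sq_abs (X x)]; field_simp; ring
    have : 0 ≤ (2 * s)⁻¹ * (|X x| - s) ^ 2 := by positivity
    linarith
  have hi : Integrable (fun x => (2 * s)⁻¹ * X x ^ 2 + s / 2) μ :=
    (hX2.const_mul _).add (integrable_const _)
  have hXi : Integrable X μ := hi.mono' hX (ae_of_all _ hb)
  refine ⟨hXi, (integral_mono hXi.abs hi hb).trans ?_⟩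
  rw [integral_add (hX2.const_mul _) (integrable_const _), integral_const_mul, integral_const]
  simp only [probReal_univ, smul_eq_mul, one_mul]
  calc _ ≤ (2 * s)⁻¹ * s ^ 2 + s / 2 := by gcongr
    _ = s := by field_simp; ring

lemma integral_abs_norm_sq_sub_one_le {n : ℕ} (hn : 0 < n) (hE : Module.finrank ℂ E = n) :
    Integrable (fun x : E => ‖x‖ ^ 2 - 1) (gaussMeasure E n) ∧
      ∫ x : E, |‖x‖ ^ 2 - 1| ∂(gaussMeasure E n) ≤ (√n)⁻¹ := by
  have := isProbabilityMeasure_gaussMeasure (E := E) hn hE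
  have h := integral_norm_sq_sub_one_sq_gaussMeasure (E := E) hn hE
  refine integral_abs_le_of_integral_sq (by fun_prop) ?_ (by positivity) ?_
  · refine not_imp_comm.1 integral_undef ?_
    rw [h]; positivity
  · rw [h, inv_pow, Real.sq_sqrt (by positivity), one_div]

lemma integral_abs_real_inner_le {n : ℕ} (hn : 0 < n) (hE : Module.finrank ℂ E = n)
    {ψ : E} (hψ : ‖ψ‖ = 1) :
    Integrable (fun x : E => inner ℝ ψ x) (gaussMeasure E n) ∧
      ∫ x : E, |inner ℝ ψ x| ∂(gaussMeasure E n) ≤ (√n)⁻¹ := by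
  have := isProbabilityMeasure_gaussMeasure (E := E) hn hE
  have h := integral_inner_sq_gaussMeasure (E := E) hn hE hψ
  have hi : Integrable (fun x : E => ‖inner ℂ ψ x‖ ^ 2) (gaussMeasure E n) := by
    refine not_imp_comm.1 integral_undef ?_
    rw [h]; positivity
  have hle : ∀ x : E, inner ℝ ψ x ^ 2 ≤ ‖inner ℂ ψ x‖ ^ 2 := fun x => by
    rw [← sq_abs]
    gcongr
    exact abs_real_inner_le_norm_inner ψ x
  have hi2 : Integrable (fun x : E => inner ℝ ψ x ^ 2) (gaussMeasure E n) :=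
    hi.mono' (by fun_prop) (ae_of_all _ fun x => by
      rw [Real.norm_of_nonneg (sq_nonneg _)]; exact hle x)
  refine integral_abs_le_of_integral_sq (by fun_prop) hi2 (by positivity) ?_
  refine (integral_mono hi2 hi hle).trans ?_
  rw [h, inv_pow, Real.sq_sqrt (by positivity), one_div]

lemma measurePreserving_neg_gaussMeasure (n : ℕ) :
    MeasurePreserving (fun x : E => -x) (gaussMeasure E n) (gaussMeasure E n) :=
  measurePreserving_gaussMeasure n (LinearIsometryEquiv.neg ℂ)

/-- Change of variables `x ↦ a • x + v` for the Gaussian measure. -/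
lemma lintegral_gaussMeasure_smul_add {n : ℕ} (hE : Module.finrank ℂ E = n) {a : ℝ} (ha : 0 < a)
    (v : E) {f : E → ENNReal} (hf : Measurable f) :
    ∫⁻ x, f x ∂(gaussMeasure E n) = ENNReal.ofReal (a ^ (2 * n)) *
      ∫⁻ x, ENNReal.ofReal (Real.exp (n * (‖x‖ ^ 2 - ‖a • x + v‖ ^ 2))) * f (a • x + v)
        ∂(gaussMeasure E n) := by
  have hd : Module.finrank ℝ E = 2 * n := by
    rw [← Module.finrank_mul_finrank ℝ ℂ E, Complex.finrank_real_complex, hE]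
  have hg : Measurable fun x : E => ENNReal.ofReal (gaussDensity n x) * f x :=
    (continuous_gaussDensity n).measurable.ennreal_ofReal.mul hf
  have hg2 : Measurable fun x : E => ENNReal.ofReal (gaussDensity n (x + v)) * f (x + v) :=
    hg.comp (measurable_add_const v)
  rw [lintegral_gaussMeasure n hf, lintegral_gaussMeasure n (by fun_prop),
    ← lintegral_add_right_eq_self _ v]
  have hmap := Measure.map_addHaar_smul (volume : Measure E) ha.ne'
  have h1 : ∫⁻ x : E, ENNReal.ofReal (gaussDensity n (a • x + v)) * f (a • x + v) =
      ENNReal.ofReal |(a ^ (2 * n))⁻¹| *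
        ∫⁻ x : E, ENNReal.ofReal (gaussDensity n (x + v)) * f (x + v) := by
    rw [← lintegral_map (f := fun x : E => ENNReal.ofReal (gaussDensity n (x + v)) * f (x + v))
      (g := fun x => a • x) hg2 (measurable_const_smul a), hmap, lintegral_smul_measure, hd,
      smul_eq_mul]
  have h2 : ∀ x : E, ENNReal.ofReal (gaussDensity n x) *
      (ENNReal.ofReal (Real.exp (n * (‖x‖ ^ 2 - ‖a • x + v‖ ^ 2))) * f (a • x + v)) =
      ENNReal.ofReal (gaussDensity n (a • x + v)) * f (a • x + v) := by
    intro x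
    rw [← mul_assoc, ← ENNReal.ofReal_mul (gaussDensity_nonneg n x)]
    congr 2
    unfold gaussDensity
    rw [mul_assoc, ← Real.exp_add]
    congr 2
    ring
  simp_rw [h2]
  rw [h1, ← mul_assoc, ← ENNReal.ofReal_mul (by positivity), abs_of_pos (by positivity),
    mul_inv_cancel₀ (by positivity), ENNReal.ofReal_one, one_mul]

end QuadraticLowerBound

section QuadraticBound

open MeasureTheory

variable {E : Type*} [NormedAddCommGroup E] [InnerProductSpace ℂ E] [FiniteDimensional ℂ E]
  [InnerProductSpace ℝ E] [IsScalarTower ℝ ℂ E] [FiniteDimensional ℝ E]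
  [MeasurableSpace E] [BorelSpace E]

lemma abs_sub_normalize_le {E : Type*} [NormedAddCommGroup E] [NormedSpace ℝ E] {q : E → ℝ}
    {D : ℝ} (hD : 0 ≤ D) (hqs : ∀ (t : ℝ) x, q (t • x) = t ^ 2 * q x) (hqb : ∀ x, |q x| ≤ D * ‖x‖ ^ 2)
    (x : E) : |q (‖x‖⁻¹ • x)| ≤ D ∧ |q x - q (‖x‖⁻¹ • x)| ≤ D * |‖x‖ ^ 2 - 1| := by
  by_cases hx : x = 0
  · have h0 : q 0 = 0 := by simpa using hqs 0 0
    simp only [hx, smul_zero, h0, abs_zero, sub_self]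
    exact ⟨hD, by positivity⟩
  · have hx' : ‖x‖ ≠ 0 := norm_ne_zero_iff.2 hx
    have h1 : |q (‖x‖⁻¹ • x)| ≤ D := by
      have := hqb (‖x‖⁻¹ • x)
      rwa [norm_smul, norm_inv, norm_norm, inv_mul_cancel₀ hx', one_pow, mul_one] at this
    refine ⟨h1, ?_⟩
    have h2 : q x = ‖x‖ ^ 2 * q (‖x‖⁻¹ • x) := by
      rw [hqs]; field_simp
    rw [h2, ← sub_one_mul, abs_mul, mul_comm]
    gcongr

lemma integral_comp_neg_gaussMeasure (n : ℕ) {f : E → ℝ} (hf : Integrable f (gaussMeasure E n)) :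
    Integrable (fun x => f (-x)) (gaussMeasure E n) ∧
      ∫ x, f (-x) ∂(gaussMeasure E n) = ∫ x, f x ∂(gaussMeasure E n) :=
  ⟨(measurePreserving_neg_gaussMeasure n).integrable_comp_of_integrable hf,
    (measurePreserving_neg_gaussMeasure n).integral_comp (Homeomorph.neg E).measurableEmbedding f⟩

/-- A real quadratic form whose exponential moments on the sphere are bounded in both directions
is bounded at every unit vector. -/
lemma quadratic_le_of_lintegral_exp_le {n : ℕ} (hn : 0 < n) (hE : Module.finrank ℂ E = n)
    {q : E → ℝ} {D T C σ : ℝ} (hD : 0 ≤ D) (hT : 0 < T) (hσ : 0 < σ) (hσ1 : σ < 1)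
    (hqc : Continuous q) (hqs : ∀ (t : ℝ) x, q (t • x) = t ^ 2 * q x)
    (hqp : ∀ x y, q (x + y) + q (x - y) = 2 * q x + 2 * q y) (hqb : ∀ x, |q x| ≤ D * ‖x‖ ^ 2)
    (h1 : ∫⁻ g : E, ENNReal.ofReal (Real.exp (n * T * q (‖g‖⁻¹ • g))) ∂(gaussMeasure E n) ≤
      ENNReal.ofReal (Real.exp (n * C)))
    (h2 : ∫⁻ g : E, ENNReal.ofReal (Real.exp (n * T * -q (‖g‖⁻¹ • g))) ∂(gaussMeasure E n) ≤
      ENNReal.ofReal (Real.exp (n * C)))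
    {ψ : E} (hψ : ‖ψ‖ = 1) :
    (1 - σ) * q ψ ≤ ((1 + σ) * C - Real.log σ) / T + 3 * D / √n := by
  have := isProbabilityMeasure_gaussMeasure (E := E) hn hE
  have hn0 : (0 : ℝ) < n := by positivity
  set γ := gaussMeasure E n
  have hu := fun x => (abs_sub_normalize_le hD hqs hqb x).1
  have hqu := fun x => (abs_sub_normalize_le hD hqs hqb x).2
  set u : E → ℝ := fun x => q (‖x‖⁻¹ • x) with hu_def
  have hum : Measurable u := hqc.measurable.comp (by fun_prop)
  obtain ⟨hN, hN1⟩ := integral_abs_norm_sq_sub_one_le (E := E) hn hE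
  obtain ⟨hI, hI1⟩ := integral_abs_real_inner_le (E := E) hn hE hψ
  have hI0 : ∫ x : E, inner ℝ ψ x ∂γ = 0 := by
    have := (integral_comp_neg_gaussMeasure n hI).2
    simp only [inner_neg_right, integral_neg] at this
    linarith
  set s := √σ
  set t := √(1 - σ)
  have hs0 : 0 < s := Real.sqrt_pos.2 hσ
  have hs : s ^ 2 = σ := Real.sq_sqrt hσ.le
  have ht : t ^ 2 = 1 - σ := Real.sq_sqrt (by linarith)
  set h : E → E := fun g => s • g + t • ψ with hh_def
  have hhm : Measurable h := by fun_prop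
  have hnorm : ∀ g, ‖h g‖ ^ 2 - 1 = σ * (‖g‖ ^ 2 - 1) + 2 * s * t * inner ℝ ψ g := by
    intro g
    rw [hh_def, norm_add_sq_real, norm_smul, norm_smul, mul_pow, mul_pow, hψ, Real.norm_eq_abs,
      Real.norm_eq_abs, sq_abs, sq_abs, hs, ht, inner_smul_left, inner_smul_right,
      real_inner_comm]
    simp; ring
  have hst : |2 * s * t| ≤ 1 := by
    rw [abs_le]; constructor <;> nlinarith [sq_nonneg (s - t), sq_nonneg (s + t)]
  have hhi : Integrable (fun g => ‖h g‖ ^ 2 - 1) γ := by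
    simp_rw [hnorm]; exact (hN.const_mul _).add (hI.const_mul _)
  have hh0 : ∫ g, ‖h g‖ ^ 2 - 1 ∂γ = 0 := by
    simp_rw [hnorm]
    rw [integral_add (hN.const_mul _) (hI.const_mul _), integral_const_mul, integral_const_mul,
      hI0, integral_sub (integrable_norm_sq_gaussMeasure hn hE) (integrable_const _),
      integral_norm_sq_gaussMeasure hn hE]
    simp
  have hhabs : ∫ g, |‖h g‖ ^ 2 - 1| ∂γ ≤ 2 * (√n)⁻¹ := by
    calc ∫ g, |‖h g‖ ^ 2 - 1| ∂γ ≤ ∫ g, (|‖g‖ ^ 2 - 1| + |inner ℝ ψ g|) ∂γ := by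
          refine integral_mono hhi.abs (hN.abs.add hI.abs) fun g => ?_
          simp only [hnorm]
          refine (abs_add_le _ _).trans ?_
          rw [abs_mul, abs_mul, abs_of_pos hσ]
          exact add_le_add (mul_le_of_le_one_left (abs_nonneg _) hσ1.le)
            (mul_le_of_le_one_left (abs_nonneg _) hst)
      _ ≤ 2 * (√n)⁻¹ := by
          rw [integral_add hN.abs hI.abs]; linarith
  have hui : Integrable u γ := Integrable.of_bound hum.aestronglyMeasurable D (ae_of_all _ hu)
  have huhi : Integrable (fun g => u (h g)) γ :=
    Integrable.of_bound (hum.comp hhm).aestronglyMeasurable D (ae_of_all _ fun g => hu _)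
  have hqi : Integrable q γ := by
    refine ((integrable_norm_sq_gaussMeasure hn hE).const_mul D).mono'
      hqc.aestronglyMeasurable (ae_of_all _ hqb)
  have hqhi : Integrable (fun g => q (h g)) γ := by
    have hi : Integrable (fun g => D * (‖h g‖ ^ 2 - 1) + D) γ :=
      (hhi.const_mul D).add (integrable_const _)
    refine hi.mono' (hqc.measurable.comp hhm).aestronglyMeasurable (ae_of_all _ fun g => ?_)
    exact (hqb (h g)).trans (le_of_eq (by ring))
  -- lower bound for the average of `u`
  have hA : -(C / T) ≤ ∫ g, u g ∂γ := by
    have hJ := (ofReal_exp_integral_le_lintegral (hui.neg.const_mul (n * T))).trans h2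
    rw [ENNReal.ofReal_le_ofReal_iff (Real.exp_pos _).le, Real.exp_le_exp, integral_const_mul,
      mul_assoc, mul_le_mul_iff_right₀ hn0] at hJ
    simp only [Pi.neg_apply, integral_neg] at hJ
    rw [neg_le, le_div_iff₀ hT]
    linarith
  -- upper bound for the average of `u` along the interpolation
  have hB : ∫ g, u (h g) ∂γ ≤ (C - Real.log σ) / T := by
    rw [lintegral_gaussMeasure_smul_add hE hs0 (t • ψ) (by fun_prop)] at h1
    have hX : Integrable (fun g => n * ((‖g‖ ^ 2 - 1) - (‖h g‖ ^ 2 - 1))) γ :=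
      (hN.sub hhi).const_mul _
    have hY : Integrable (fun g => n * T * u (h g)) γ := huhi.const_mul _
    have hJ := ofReal_exp_integral_le_lintegral (hX.add hY)
    simp only [Pi.add_apply] at hJ
    rw [integral_add hX hY, integral_const_mul,
      integral_const_mul, integral_sub hN hhi, hh0,
      integral_sub (integrable_norm_sq_gaussMeasure hn hE) (integrable_const _),
      integral_norm_sq_gaussMeasure hn hE] at hJ
    simp only [integral_const, probReal_univ, smul_eq_mul, one_mul, sub_self, mul_zero,
      zero_add] at hJ
    have h3 : ENNReal.ofReal (s ^ (2 * n)) * ENNReal.ofReal (Real.exp (n * T * ∫ g, u (h g) ∂γ)) ≤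
        ENNReal.ofReal (Real.exp (n * C)) := by
      refine le_trans (mul_le_mul_right (hJ.trans (le_of_eq ?_)) _) h1
      refine lintegral_congr fun g => ?_
      rw [← ENNReal.ofReal_mul (Real.exp_pos _).le, ← Real.exp_add]
      congr 2
      simp only [hu_def, hh_def]
      ring
    have hsn : s ^ (2 * n) = Real.exp (n * Real.log σ) := by
      rw [pow_mul, hs, Real.exp_nat_mul, Real.exp_log hσ]
    rw [hsn, ← ENNReal.ofReal_mul (Real.exp_pos _).le, ← Real.exp_add,
      ENNReal.ofReal_le_ofReal_iff (Real.exp_pos _).le, Real.exp_le_exp, mul_assoc, ← mul_add,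
      mul_le_mul_iff_right₀ hn0] at h3
    rw [le_div_iff₀ hT]
    linarith
  have hC : ∫ g, q g ∂γ ≥ ∫ g, u g ∂γ - D * (√n)⁻¹ := by
    have : ∫ g, (u g - q g) ∂γ ≤ ∫ g, D * |‖g‖ ^ 2 - 1| ∂γ :=
      integral_mono (hui.sub hqi) (hN.abs.const_mul D) fun g => by
        have := (abs_le.1 (hqu g)).1
        simp only; linarith
    rw [integral_sub hui hqi, integral_const_mul] at this
    have := mul_le_mul_of_nonneg_left hN1 hD
    linarith
  have hF : ∫ g, q (h g) ∂γ ≤ ∫ g, u (h g) ∂γ + D * (2 * (√n)⁻¹) := by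
    have : ∫ g, (q (h g) - u (h g)) ∂γ ≤ ∫ g, D * |‖h g‖ ^ 2 - 1| ∂γ :=
      integral_mono (hqhi.sub huhi) (hhi.abs.const_mul D) fun g => (abs_le.1 (hqu (h g))).2
    rw [integral_sub hqhi huhi, integral_const_mul] at this
    have := mul_le_mul_of_nonneg_left hhabs hD
    linarith
  have hG : ∫ g, q (h g) ∂γ = σ * ∫ g, q g ∂γ + (1 - σ) * q ψ := by
    obtain ⟨hnegi, hneg⟩ := integral_comp_neg_gaussMeasure n hqhi
    have hsum : ∀ g, q (h g) + q (h (-g)) = 2 * (σ * q g + (1 - σ) * q ψ) := by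
      intro g
      have := hqp (t • ψ) (s • g)
      rw [hqs, hqs, hs, ht] at this
      simp only [hh_def, smul_neg]
      rw [add_comm (s • g), add_comm (-(s • g)), ← sub_eq_add_neg, this]
      ring
    have h4 : ∫ g, (q (h g) + q (h (-g))) ∂γ = 2 * (σ * ∫ g, q g ∂γ + (1 - σ) * q ψ) := by
      simp_rw [hsum]
      rw [integral_const_mul, integral_add (hqi.const_mul _) (integrable_const _),
        integral_const_mul]
      simp
    rw [integral_add hqhi hnegi] at h4
    linarith
  have e : ((1 + σ) * C - Real.log σ) / T + 3 * D / √n =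
      (C - Real.log σ) / T + σ * (C / T) + 3 * (D * (√n)⁻¹) := by
    field_simp
    ring
  have h5 := mul_le_mul_of_nonneg_left (hA.trans (show _ ≤ ∫ g, q g ∂γ + D * (√n)⁻¹ by linarith))
    hσ.le
  have h6 : σ * (D * (√n)⁻¹) ≤ D * (√n)⁻¹ :=
    mul_le_of_le_one_left (by positivity) hσ1.le
  rw [e]
  linarith

end QuadraticBound

section Net

variable {ι : Type*} [Fintype ι]

lemma exists_int_div_near {N : ℕ} (hN : 0 < N) {x : ℝ} (hx : |x| ≤ 1) :
    ∃ k ∈ Finset.Icc (-(N : ℤ)) N, |(k / N : ℝ)| ≤ |x| ∧ |x - k / N| ≤ 1 / N := by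
  have hN0 : (0 : ℝ) < N := by positivity
  have key : ∀ y : ℝ, 0 ≤ y → y ≤ 1 → ∃ k : ℕ, k ≤ N ∧ (k / N : ℝ) ≤ y ∧ y ≤ k / N + 1 / N := by
    intro y hy hy1
    have h1 := Nat.floor_le (show 0 ≤ N * y by positivity)
    have h2 := (Nat.lt_floor_add_one (N * y)).le
    refine ⟨⌊N * y⌋₊, ?_, ?_, ?_⟩
    · have : (⌊N * y⌋₊ : ℝ) ≤ N := h1.trans (mul_le_of_le_one_right hN0.le hy1)
      exact_mod_cast this
    · rwa [div_le_iff₀ hN0, mul_comm y]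
    · rwa [← add_div, le_div_iff₀ hN0, mul_comm y]
  obtain ⟨k, hk, h1, h2⟩ := key |x| (abs_nonneg x) hx
  have hk0 : (0 : ℝ) ≤ k / N := by positivity
  rcases le_total 0 x with h | h
  · rw [abs_of_nonneg h] at h1 h2 ⊢
    refine ⟨k, Finset.mem_Icc.2 ⟨by omega, by omega⟩, ?_, ?_⟩
    · rwa [Int.cast_natCast, abs_of_nonneg hk0]
    · rw [Int.cast_natCast, abs_le]; constructor <;> linarith [show (0 : ℝ) ≤ 1 / N by positivity]
  · rw [abs_of_nonpos h] at h1 h2 ⊢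
    refine ⟨-k, Finset.mem_Icc.2 ⟨by omega, by omega⟩, ?_, ?_⟩
    · push_cast
      rwa [neg_div, abs_neg, abs_of_nonneg hk0]
    · push_cast
      rw [abs_le, neg_div]; constructor <;> linarith [show (0 : ℝ) ≤ 1 / N by positivity]

lemma exists_finset_matrix_net {N : ℕ} (hN : 0 < N) :
    ∃ S : Finset (Matrix ι ι ℂ),
      S.card ≤ (2 * N + 1) ^ (2 * Fintype.card ι ^ 2) ∧
      (∀ a ∈ S, (∀ i, a i i = 0) ∧ ∑ i, ∑ j, ‖a i j‖ ^ 2 ≤ 1 ∧ -a ∈ S) ∧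
      ∀ a : Matrix ι ι ℂ, (∀ i, a i i = 0) → ∑ i, ∑ j, ‖a i j‖ ^ 2 ≤ 1 →
        ∃ b ∈ S, ∀ i j, ‖a i j - b i j‖ ≤ 2 / N := by
  classical
  let I : Finset (ℤ × ℤ) := Finset.Icc (-(N : ℤ)) N ×ˢ Finset.Icc (-(N : ℤ)) N
  let P : Finset (ι × ι → ℤ × ℤ) := Fintype.piFinset fun _ => I
  let M : (ι × ι → ℤ × ℤ) → Matrix ι ι ℂ := fun f i j =>
    ⟨(f (i, j)).1 / N, (f (i, j)).2 / N⟩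
  let S : Finset (Matrix ι ι ℂ) := (P.image M).filter fun a =>
    (∀ i, a i i = 0) ∧ ∑ i, ∑ j, ‖a i j‖ ^ 2 ≤ 1
  refine ⟨S, ?_, ?_, ?_⟩
  · calc S.card ≤ (P.image M).card := Finset.card_filter_le _ _
      _ ≤ P.card := Finset.card_image_le
      _ = (2 * N + 1) ^ (2 * Fintype.card ι ^ 2) := by
        unfold P I
        rw [Fintype.card_piFinset, Finset.prod_const, Finset.card_univ, Finset.card_product,
          Int.card_Icc, Fintype.card_prod, ← pow_two, ← pow_mul, ← pow_two]
        congr 1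
        omega
  · intro a ha
    obtain ⟨ha1, ha2, ha3⟩ := Finset.mem_filter.1 ha
    refine ⟨ha2, ha3, Finset.mem_filter.2 ⟨?_, fun i => by simp [ha2], by simpa using ha3⟩⟩
    obtain ⟨f, hf, rfl⟩ := Finset.mem_image.1 ha1
    refine Finset.mem_image.2 ⟨-f, ?_, ?_⟩
    · rw [Fintype.mem_piFinset] at hf ⊢
      intro p
      have := hf p
      simp only [I, Finset.mem_product, Finset.mem_Icc, Pi.neg_apply, Prod.fst_neg,
        Prod.snd_neg] at this ⊢
      omega
    · ext i j
      rw [Matrix.neg_apply]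
      apply Complex.ext <;> simp [M, neg_div]
  · intro a ha1 ha2
    have hle : ∀ i j, ‖a i j‖ ≤ 1 := fun i j => by
      have h1 : ‖a i j‖ ^ 2 ≤ ∑ j, ‖a i j‖ ^ 2 :=
        Finset.single_le_sum (f := fun j => ‖a i j‖ ^ 2) (fun _ _ => sq_nonneg _)
          (Finset.mem_univ j)
      have h2 : ∑ j, ‖a i j‖ ^ 2 ≤ ∑ i, ∑ j, ‖a i j‖ ^ 2 :=
        Finset.single_le_sum (f := fun i => ∑ j, ‖a i j‖ ^ 2)
          (fun _ _ => Finset.sum_nonneg fun _ _ => sq_nonneg _) (Finset.mem_univ i)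
      have := (h1.trans h2).trans ha2
      rwa [sq_le_one_iff₀ (norm_nonneg _)] at this
    have h : ∀ p : ι × ι, ∃ k : ℤ × ℤ, k ∈ I ∧
        (|(k.1 / N : ℝ)| ≤ |(a p.1 p.2).re| ∧ |(a p.1 p.2).re - k.1 / N| ≤ 1 / N) ∧
        |(k.2 / N : ℝ)| ≤ |(a p.1 p.2).im| ∧ |(a p.1 p.2).im - k.2 / N| ≤ 1 / N := by
      intro p
      obtain ⟨k, hk, hk'⟩ := exists_int_div_near hN
        ((Complex.abs_re_le_norm _).trans (hle p.1 p.2))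
      obtain ⟨l, hl, hl'⟩ := exists_int_div_near hN
        ((Complex.abs_im_le_norm _).trans (hle p.1 p.2))
      exact ⟨(k, l), Finset.mem_product.2 ⟨hk, hl⟩, hk', hl'⟩
    choose f hfI hf1 hf2 using h
    have hnorm : ∀ i j, ‖M f i j‖ ^ 2 ≤ ‖a i j‖ ^ 2 := by
      intro i j
      rw [← Complex.normSq_eq_norm_sq, ← Complex.normSq_eq_norm_sq, Complex.normSq_apply,
        Complex.normSq_apply, ← pow_two, ← pow_two, ← pow_two, ← pow_two]
      exact add_le_add (sq_le_sq.2 (hf1 (i, j)).1) (sq_le_sq.2 (hf2 (i, j)).1)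
    refine ⟨M f, Finset.mem_filter.2 ⟨Finset.mem_image_of_mem _ (Fintype.mem_piFinset.2 hfI),
      fun i => ?_, ?_⟩, fun i j => ?_⟩
    · have := hnorm i i
      rw [ha1] at this
      simpa using this
    · exact (Finset.sum_le_sum fun i _ => Finset.sum_le_sum fun j _ => hnorm i j).trans ha2
    · refine (Complex.norm_le_abs_re_add_abs_im _).trans ?_
      calc _ ≤ 1 / (N : ℝ) + 1 / N := add_le_add (hf1 (i, j)).2 (hf2 (i, j)).2
        _ = 2 / N := by ring

end Net

section QuadFormBounds

variable {ι E : Type*} [Fintype ι] [NormedAddCommGroup E] [InnerProductSpace ℂ E]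

lemma quadForm_neg (a : Matrix ι ι ℂ) (x : ι → E) : quadForm (-a) x = -quadForm a x := by
  simp [quadForm]

lemma quadForm_add_add_sub (a : Matrix ι ι ℂ) (x y : ι → E) :
    quadForm a (x + y) + quadForm a (x - y) = 2 * quadForm a x + 2 * quadForm a y := by
  unfold quadForm
  simp only [Finset.mul_sum, ← Finset.sum_add_distrib]
  refine Finset.sum_congr rfl fun i _ => Finset.sum_congr rfl fun j _ => ?_
  simp only [Pi.add_apply, Pi.sub_apply, inner_add_left, inner_add_right, inner_sub_left,
    inner_sub_right, mul_add, mul_sub, Complex.add_re, Complex.sub_re]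
  ring

lemma abs_quadForm_le (a : Matrix ι ι ℂ) {x : ι → E} {r : ℝ} (hx : ∀ i, ‖x i‖ = r) :
    |quadForm a x| ≤ (∑ i, ∑ j, ‖a i j‖) * r ^ 2 := by
  unfold quadForm
  rw [Finset.sum_mul]
  refine (Finset.abs_sum_le_sum_abs _ _).trans (Finset.sum_le_sum fun i _ => ?_)
  rw [Finset.sum_mul]
  refine (Finset.abs_sum_le_sum_abs _ _).trans (Finset.sum_le_sum fun j _ => ?_)
  refine (Complex.abs_re_le_norm _).trans ?_
  rw [norm_mul]
  gcongr
  have := norm_inner_le_norm (𝕜 := ℂ) (x i) (x j)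
  rwa [hx, hx, ← pow_two] at this

lemma sum_norm_le_card {a : Matrix ι ι ℂ} (ha : ∑ i, ∑ j, ‖a i j‖ ^ 2 ≤ 1) :
    ∑ i, ∑ j, ‖a i j‖ ≤ Fintype.card ι := by
  rw [← Finset.sum_product' (f := fun i j => ‖a i j‖)]
  rw [← Finset.sum_product' (f := fun i j => ‖a i j‖ ^ 2)] at ha
  refine abs_le_of_sq_le_sq' ?_ (by positivity) |>.2
  refine (sq_sum_le_card_mul_sum_sq).trans ?_
  rw [Finset.card_product, Finset.card_univ]
  push_cast
  rw [← pow_two]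
  exact mul_le_of_le_one_right (by positivity) ha

lemma quadForm_sub (a b : Matrix ι ι ℂ) (x : ι → E) :
    quadForm (a - b) x = quadForm a x - quadForm b x := by
  simp [quadForm, sub_mul]

/-- Optimising the quadratic form over its coefficients gives the off-diagonal Gram norm. -/
lemma sum_offDiag_norm_inner_sq_le [DecidableEq ι] {x : ι → E} {B : ℝ}
    (h : ∀ a : Matrix ι ι ℂ, (∀ i, a i i = 0) → ∑ i, ∑ j, ‖a i j‖ ^ 2 ≤ 1 → quadForm a x ≤ B) :
    ∑ i, ∑ j, (if i = j then 0 else ‖inner ℂ (x i) (x j)‖ ^ 2) ≤ B ^ 2 := by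
  set F := ∑ i, ∑ j, (if i = j then 0 else ‖inner ℂ (x i) (x j)‖ ^ 2) with hF
  have hF0 : 0 ≤ F := Finset.sum_nonneg fun i _ => Finset.sum_nonneg fun j _ => by positivity
  rcases hF0.eq_or_lt with h0 | h0
  · rw [← h0]; positivity
  have hs : 0 < √F := Real.sqrt_pos.2 h0
  let a : Matrix ι ι ℂ := fun i j =>
    if i = j then 0 else (√F : ℂ)⁻¹ * (starRingEnd ℂ) (inner ℂ (x i) (x j))
  have h1 : ∑ i, ∑ j, ‖a i j‖ ^ 2 = 1 := by
    have e : ∀ i j, ‖a i j‖ ^ 2 = F⁻¹ * (if i = j then 0 else ‖inner ℂ (x i) (x j)‖ ^ 2) := by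
      intro i j
      by_cases hij : i = j
      · simp [a, hij]
      · simp only [a, hij, if_false, norm_mul, RCLike.norm_conj, mul_pow, norm_inv,
          Complex.norm_real, Real.norm_eq_abs, sq_abs, inv_pow, Real.sq_sqrt hF0]
    simp_rw [e, ← Finset.mul_sum]
    rw [← hF, inv_mul_cancel₀ h0.ne']
  have h2 : quadForm a x = √F := by
    have e : ∀ i j, (a i j * inner ℂ (x i) (x j)).re =
        (√F)⁻¹ * (if i = j then 0 else ‖inner ℂ (x i) (x j)‖ ^ 2) := by
      intro i j
      by_cases hij : i = j
      · simp [a, hij]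
      · simp only [a, hij, if_false]
        rw [mul_assoc, ← Complex.normSq_eq_conj_mul_self, Complex.normSq_eq_norm_sq,
          ← Complex.ofReal_inv, ← Complex.ofReal_mul, Complex.ofReal_re]
    unfold quadForm
    simp_rw [e, ← Finset.mul_sum]
    rw [← hF, inv_mul_eq_iff_eq_mul₀ hs.ne', Real.mul_self_sqrt hF0]
  have h3 := h a (fun i => by simp [a]) h1.le
  rw [h2] at h3
  calc F = √F ^ 2 := (Real.sq_sqrt hF0).symm
    _ ≤ B ^ 2 := by gcongr

end QuadFormBounds

section IncoherentUnitaries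

open MeasureTheory

variable {E : Type*} [NormedAddCommGroup E] [InnerProductSpace ℂ E] [FiniteDimensional ℂ E]
  [InnerProductSpace ℝ E] [IsScalarTower ℝ ℂ E] [FiniteDimensional ℝ E]
  [MeasurableSpace E] [BorelSpace E]

lemma one_sub_le_integral_norm_gaussMeasure {n : ℕ} (hn : 0 < n) (hE : Module.finrank ℂ E = n) :
    1 - 1 / (2 * n : ℝ) ≤ ∫ x : E, ‖x‖ ∂(gaussMeasure E n) := by
  have h2 := integrable_norm_sq_gaussMeasure (E := E) hn hE
  have h4 := integrable_norm_pow_four_gaussMeasure (E := E) hn hE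
  have h : ∫ x : E, ((3 / 2) * ‖x‖ ^ 2 - (1 / 2) * ‖x‖ ^ 4) ∂(gaussMeasure E n) ≤
      ∫ x : E, ‖x‖ ∂(gaussMeasure E n) := by
    refine integral_mono ((h2.const_mul _).sub (h4.const_mul _))
      (integrable_norm_gaussMeasure hn hE) fun x => ?_
    have h0 := norm_nonneg x
    have : 0 ≤ ‖x‖ * ((‖x‖ - 1) ^ 2 * (‖x‖ + 2)) := by positivity
    simp only
    nlinarith
  rw [integral_sub (h2.const_mul _) (h4.const_mul _), integral_const_mul, integral_const_mul,
    integral_norm_sq_gaussMeasure hn hE, integral_norm_pow_four_gaussMeasure hn hE] at h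
  refine le_trans (le_of_eq ?_) h
  have : (n : ℝ) ≠ 0 := by positivity
  field_simp
  ring

/-- There are unitaries whose orbits of every unit vector have small off-diagonal Gram matrix. -/
theorem exists_unitaries_sum_offDiag_le {ι : Type*} [Fintype ι] [DecidableEq ι] {n N : ℕ}
    (hn : 0 < n) (hN : 0 < N) (hE : Module.finrank ℂ E = n) {σ τ κ B : ℝ}
    (hσ : 0 < σ) (hσ1 : σ < 1) (hτ : 0 < τ) (hτ1 : τ < 1)
    (hκ : 2 * (Fintype.card ι : ℝ) ^ 2 * Real.log (2 * N + 1) ≤ n * κ)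
    (hB : (((1 + σ) * (-Real.log (1 - τ) - τ + κ) - Real.log σ) /
        (τ * (∫ x : E, ‖x‖ ∂(gaussMeasure E n)) ^ 2) + 3 * Fintype.card ι / √n) / (1 - σ) +
        (Fintype.card ι : ℝ) ^ 2 * (2 / N) ≤ B) :
    ∃ V : ι → E ≃ₗᵢ[ℂ] E, ∀ ψ : E, ‖ψ‖ = 1 →
      ∑ i, ∑ j, (if i = j then 0 else ‖inner ℂ (V i ψ) (V j ψ)‖ ^ 2) ≤ B ^ 2 := by
  obtain ⟨S, hcard, hS, hnet⟩ := exists_finset_matrix_net (ι := ι) hN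
  obtain ⟨V, hV⟩ := exists_unitaries_lintegral_exp_le (E := E) hn hE hτ hτ1 S
    (fun a ha => (hS a ha).1) (fun a ha => (hS a ha).2.1)
  refine ⟨V, fun ψ hψ => sum_offDiag_norm_inner_sq_le fun a ha1 ha2 => ?_⟩
  have hn0 : (0 : ℝ) < n := by positivity
  have hρ : 0 < ∫ x : E, ‖x‖ ∂(gaussMeasure E n) := by
    refine lt_of_lt_of_le ?_ (one_sub_le_integral_norm_gaussMeasure hn hE)
    rw [sub_pos, div_lt_one (by positivity)]
    have : (1 : ℝ) ≤ n := by exact_mod_cast hn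
    linarith
  have hbound : ∀ b ∈ S,
      ∫⁻ g : E, ENNReal.ofReal (Real.exp (n * (τ * (∫ x : E, ‖x‖ ∂(gaussMeasure E n)) ^ 2) *
        quadForm b (fun i => V i (‖g‖⁻¹ • g)))) ∂(gaussMeasure E n) ≤
      ENNReal.ofReal (Real.exp (n * (-Real.log (1 - τ) - τ + κ))) := by
    intro b hb
    refine (hV b hb).trans ?_
    rw [← ENNReal.ofReal_natCast, ← ENNReal.ofReal_mul (by positivity), mul_add (n : ℝ),
      add_comm (n * _ : ℝ), Real.exp_add]
    refine ENNReal.ofReal_le_ofReal (mul_le_mul_of_nonneg_right ?_ (Real.exp_pos _).le)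
    calc (S.card : ℝ) ≤ (2 * N + 1 : ℝ) ^ (2 * Fintype.card ι ^ 2) := by exact_mod_cast hcard
      _ = Real.exp (2 * (Fintype.card ι : ℝ) ^ 2 * Real.log (2 * N + 1)) := by
        rw [← Real.exp_log (show (0 : ℝ) < (2 * N + 1 : ℝ) ^ (2 * Fintype.card ι ^ 2) by positivity),
          Real.log_pow]
        push_cast
        rfl
      _ ≤ _ := Real.exp_le_exp.2 hκ
  obtain ⟨b, hb, hab⟩ := hnet a ha1 ha2
  have hround : quadForm a (fun i => V i ψ) - quadForm b (fun i => V i ψ) ≤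
      (Fintype.card ι : ℝ) ^ 2 * (2 / N) := by
    rw [← quadForm_sub]
    refine (le_abs_self _).trans ((abs_quadForm_le (r := 1) _ fun i => by simp [hψ]).trans ?_)
    rw [one_pow, mul_one]
    refine (Finset.sum_le_sum fun i _ => Finset.sum_le_sum fun j _ => hab i j).trans
      (le_of_eq ?_)
    simp only [Finset.sum_const, Finset.card_univ, nsmul_eq_mul]
    ring
  have hquad := quadratic_le_of_lintegral_exp_le (E := E) hn hE
    (q := fun x => quadForm b (fun i => V i x)) (D := Fintype.card ι)
    (T := τ * (∫ x : E, ‖x‖ ∂(gaussMeasure E n)) ^ 2)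
    (by positivity) (by positivity) hσ hσ1
    ((continuous_quadForm b).comp (by fun_prop))
    (fun t x => by
      have h : ∀ i, V i (t • x) = t • V i x := fun i => by
        rw [← algebraMap_smul ℂ t x, map_smul, algebraMap_smul]
      simp_rw [h]
      rw [quadForm_smul b (fun _ => t)]
      simp only [quadForm, Finset.mul_sum, pow_two])
    (fun x y => by
      have h1 : (fun i => V i (x + y)) = (fun i => V i x) + fun i => V i y := by
        ext i; simp
      have h2 : (fun i => V i (x - y)) = (fun i => V i x) - fun i => V i y := by
        ext i; simp
      simp only [h1, h2, quadForm_add_add_sub])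
    (fun x => (abs_quadForm_le (r := ‖x‖) b fun i => (V i).norm_map x).trans
      (mul_le_mul_of_nonneg_right (sum_norm_le_card (hS b hb).2.1) (sq_nonneg _)))
    (hbound b hb) (by simpa only [quadForm_neg] using hbound (-b) (hS b hb).2.2) hψ
  rw [mul_comm, ← le_div_iff₀ (by linarith)] at hquad
  linarith

lemma log_three_le : Real.log 3 ≤ 1.1 := by
  have h : Real.log ((3 : ℝ) ^ 10) ≤ 11 := by
    rw [Real.log_le_iff_le_exp (by positivity), ← mul_one (11 : ℝ),
      show (11 : ℝ) * 1 = (11 : ℕ) * 1 by norm_num, Real.exp_nat_mul]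
    calc (3 : ℝ) ^ 10 ≤ 2.7182818283 ^ 11 := by norm_num
      _ ≤ _ := by gcongr; exact Real.exp_one_gt_d9.le
  rw [Real.log_pow] at h
  push_cast at h
  linarith

lemma exists_unitaries_sum_offDiag_lt {ι : Type*} [Fintype ι] [DecidableEq ι]
    (hι : Fintype.card ι = 2 ^ 45) (hE : Module.finrank ℂ E = 2 ^ 108) :
    ∃ V : ι → E ≃ₗᵢ[ℂ] E, ∀ ψ : E, ‖ψ‖ = 1 →
      ∑ i, ∑ j, (if i = j then 0 else ‖inner ℂ (V i ψ) (V j ψ)‖ ^ 2) ≤ (3.8 : ℝ) ^ 2 := by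
  have hρ := one_sub_le_integral_norm_gaussMeasure (E := E) (n := 2 ^ 108) (by positivity) hE
  refine exists_unitaries_sum_offDiag_le (n := 2 ^ 108) (N := 2 ^ 100) (σ := 1 / 3) (τ := 2 / 3)
    (κ := 142 / 2 ^ 18) (by positivity) (by positivity) hE (by norm_num) (by norm_num)
    (by norm_num) (by norm_num) ?_ ?_
  · have h : Real.log (2 * (2 ^ 100 : ℕ) + 1) ≤ 71 := by
      calc Real.log (2 * (2 ^ 100 : ℕ) + 1) ≤ Real.log (2 ^ 102) :=
            Real.log_le_log (by positivity) (by norm_num)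
        _ = 102 * Real.log 2 := by rw [Real.log_pow]; norm_num
        _ ≤ 71 := by linarith [Real.log_two_lt_d9]
    rw [hι]
    refine (mul_le_mul_of_nonneg_left h (by positivity)).trans ?_
    norm_num
  · set ρ := ∫ x : E, ‖x‖ ∂(gaussMeasure E (2 ^ 108))
    have hT : (0.6666 : ℝ) ≤ 2 / 3 * ρ ^ 2 := by
      have : (0.99999 : ℝ) ≤ ρ := le_trans (by norm_num) hρ
      nlinarith
    have hlog : Real.log (1 / 3) = -Real.log 3 := by rw [one_div, Real.log_inv]
    have hsqrt : √((2 ^ 108 : ℕ) : ℝ) = 2 ^ 54 := by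
      rw [Real.sqrt_eq_iff_mul_self_eq (by positivity) (by positivity)]
      norm_num
    have h3 := log_three_le
    rw [hι, hsqrt, show (1 - 2 / 3 : ℝ) = 1 / 3 by norm_num, hlog]
    have h1 : ((1 + 1 / 3) * (-(-Real.log 3) - 2 / 3 + 142 / 2 ^ 18) - -Real.log 3) /
        (2 / 3 * ρ ^ 2) ≤ (1.68 : ℝ) / 0.6666 :=
      div_le_div₀ (by norm_num) (by linarith) (by norm_num) hT
    calc _ ≤ ((1.68 : ℝ) / 0.6666 + 3 * ((2 ^ 45 : ℕ) : ℝ) / 2 ^ 54) / (1 - 1 / 3) +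
          (((2 ^ 45 : ℕ) : ℝ)) ^ 2 * (2 / ((2 ^ 100 : ℕ) : ℝ)) := by gcongr
      _ ≤ 3.8 := by norm_num

end IncoherentUnitaries

section Entropy

lemma log_add_one_sub_le_vnEntropy {m : Type*} [Fintype m] [DecidableEq m] {ρ : Matrix m m ℂ}
    (hρ : ρ.PosSemidef) (htr : ρ.trace = 1) {d : ℝ} (hd : 0 < d) :
    Real.log d + 1 - d * ∑ i, ∑ j, ‖ρ i j‖ ^ 2 ≤ vnEntropy ρ := by
  have hsum : ∑ i, hρ.1.eigenvalues i = 1 := by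
    have := hρ.1.trace_eq_sum_eigenvalues
    rw [htr] at this
    exact Complex.ofReal_injective (by push_cast; exact this.symm)
  rw [vnEntropy, dif_pos hρ.1, ← hρ.1.sum_eigenvalues_sq]
  have key : ∀ i, (Real.log d + 1) * hρ.1.eigenvalues i - d * hρ.1.eigenvalues i ^ 2 ≤
      -(hρ.1.eigenvalues i * Real.log (hρ.1.eigenvalues i)) := by
    intro i
    rcases (hρ.eigenvalues_nonneg i).eq_or_lt with h | h
    · simp [← h]
    · have h1 := Real.log_le_sub_one_of_pos (mul_pos hd h)
      rw [Real.log_mul hd.ne' h.ne'] at h1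
      nlinarith
  calc Real.log d + 1 - d * ∑ i, hρ.1.eigenvalues i ^ 2
      = ∑ i, ((Real.log d + 1) * hρ.1.eigenvalues i - d * hρ.1.eigenvalues i ^ 2) := by
        rw [Finset.sum_sub_distrib, ← Finset.mul_sum, ← Finset.mul_sum, hsum, mul_one]
    _ ≤ ∑ i, -(hρ.1.eigenvalues i * Real.log (hρ.1.eigenvalues i)) :=
        Finset.sum_le_sum fun i _ => key i
    _ = _ := Finset.sum_neg_distrib _

attribute [local instance] Matrix.frobeniusNormedAddCommGroup Matrix.frobeniusNormedSpace

lemma frobenius_norm_sq {m : Type*} [Fintype m] (A : Matrix m m ℂ) :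
    ‖A‖ ^ 2 = ∑ i, ∑ j, ‖A i j‖ ^ 2 := by
  rw [Matrix.frobenius_norm_def, ← Real.sqrt_eq_rpow, Real.sq_sqrt (by positivity)]
  simp

lemma frobenius_norm_sq_sum_vecMulVec {ι m : Type*} [Fintype ι] [Fintype m]
    (x : ι → EuclideanSpace ℂ m) :
    ‖∑ i, vecMulVec (x i).ofLp (star (x i).ofLp)‖ ^ 2 = ∑ i, ∑ j, ‖inner ℂ (x i) (x j)‖ ^ 2 := by
  rw [frobenius_norm_sq]
  have hsq : ∀ z : ℂ, ((‖z‖ ^ 2 : ℝ) : ℂ) = z * star z := fun z => by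
    rw [RCLike.star_def, Complex.mul_conj, Complex.normSq_eq_norm_sq]
  have h : ((∑ a, ∑ b, ‖(∑ i, vecMulVec (x i).ofLp (star (x i).ofLp)) a b‖ ^ 2 : ℝ) : ℂ) =
      ((∑ i, ∑ j, ‖inner ℂ (x i) (x j)‖ ^ 2 : ℝ) : ℂ) := by
    simp_rw [Complex.ofReal_sum, hsq, EuclideanSpace.inner_eq_star_dotProduct, Matrix.sum_apply,
      vecMulVec_apply, dotProduct, star_sum, Finset.sum_mul_sum, Pi.star_apply]
    simp_rw [Finset.sum_comm (s := (Finset.univ : Finset m)) (t := (Finset.univ : Finset ι))]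
    rw [Finset.sum_comm]
    refine Finset.sum_congr rfl fun i _ => Finset.sum_congr rfl fun j _ =>
      Finset.sum_congr rfl fun a _ => Finset.sum_congr rfl fun b _ => ?_
    simp only [star_mul', star_star]
    ring
  exact_mod_cast h

lemma Matrix.PosSemidef.norm_map_le {m k : Type*} [Fintype m] [DecidableEq m] [Fintype k]
    (Ψ : Matrix m m ℂ →ₗ[ℂ] Matrix k k ℂ) {R : ℝ}
    (h : ∀ ψ : EuclideanSpace ℂ m, ‖ψ‖ = 1 → ‖Ψ (vecMulVec ψ.ofLp (star ψ.ofLp))‖ ≤ R)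
    {ρ : Matrix m m ℂ} (hρ : ρ.PosSemidef) (htr : ρ.trace = 1) : ‖Ψ ρ‖ ≤ R := by
  have hsum : ∑ i, hρ.1.eigenvalues i = 1 := by
    have := hρ.1.trace_eq_sum_eigenvalues
    rw [htr] at this
    exact Complex.ofReal_injective (by push_cast; exact this.symm)
  have hdec : ρ = ∑ k, (hρ.1.eigenvalues k : ℂ) •
      vecMulVec (hρ.1.eigenvectorBasis k).ofLp (star (hρ.1.eigenvectorBasis k).ofLp) := by
    ext i j
    rw [hρ.1.apply_eq_sum, Matrix.sum_apply]
    refine Finset.sum_congr rfl fun k _ => ?_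
    rw [Matrix.smul_apply, vecMulVec_apply, smul_eq_mul]
    simp only [Matrix.IsHermitian.eigenvectorUnitary_apply, Pi.star_apply, RCLike.star_def]
    ring
  rw [hdec, map_sum]
  refine (norm_sum_le _ _).trans ?_
  calc _ ≤ ∑ k, hρ.1.eigenvalues k * R := Finset.sum_le_sum fun k _ => by
        rw [map_smul, norm_smul, Complex.norm_real, Real.norm_eq_abs,
          abs_of_nonneg (hρ.eigenvalues_nonneg k)]
        exact mul_le_mul_of_nonneg_left (h _ (hρ.1.eigenvectorBasis.norm_eq_one k))
          (hρ.eigenvalues_nonneg k)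
    _ = R := by rw [← Finset.sum_mul, hsum, one_mul]

variable {n d : ℕ}

lemma posSemidef_ruChannel {w : Fin d → ℝ} (hw : ∀ i, 0 ≤ w i)
    (U : Fin d → Matrix (Fin n) (Fin n) ℂ) {ρ : Matrix (Fin n) (Fin n) ℂ} (hρ : ρ.PosSemidef) :
    (ruChannel w U ρ).PosSemidef := by
  refine Matrix.posSemidef_sum _ fun i _ => ?_
  exact (hρ.mul_mul_conjTranspose_same _).smul (by exact_mod_cast hw i)

lemma trace_ruChannel {w : Fin d → ℝ} (hw : ∑ i, w i = 1)
    {U : Fin d → Matrix (Fin n) (Fin n) ℂ} (hU : ∀ i, U i ∈ Matrix.unitaryGroup (Fin n) ℂ)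
    (ρ : Matrix (Fin n) (Fin n) ℂ) : (ruChannel w U ρ).trace = ρ.trace := by
  have h : ∀ i, ((w i : ℂ) • (U i * ρ * (U i)ᴴ)).trace = w i * ρ.trace := fun i => by
    rw [trace_smul, trace_mul_comm, ← mul_assoc, ← star_eq_conjTranspose,
      Matrix.mem_unitaryGroup_iff'.1 (hU i), one_mul, smul_eq_mul]
  rw [ruChannel, trace_sum]
  simp_rw [h]
  rw [← Finset.sum_mul]
  exact_mod_cast (by rw [hw, Complex.ofReal_one, one_mul] :
    ((∑ i, w i : ℝ) : ℂ) * ρ.trace = ρ.trace)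

/-- The random unitary channel as a linear map. -/
noncomputable def ruChannelLinear (w : Fin d → ℝ) (U : Fin d → Matrix (Fin n) (Fin n) ℂ) :
    Matrix (Fin n) (Fin n) ℂ →ₗ[ℂ] Matrix (Fin n) (Fin n) ℂ where
  toFun := ruChannel w U
  map_add' ρ ρ' := by
    simp [ruChannel, mul_add, add_mul, Finset.sum_add_distrib]
  map_smul' c ρ := by
    simp [ruChannel, Finset.smul_sum, smul_comm c]

/-- Uniformly weighted unitaries with incoherent orbits give nearly maximal output entropy. -/
theorem log_sub_le_minOutEntropy (hn : 0 < n) (hd : 0 < d)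
    {U : Fin d → Matrix (Fin n) (Fin n) ℂ} (hU : ∀ i, U i ∈ Matrix.unitaryGroup (Fin n) ℂ) {F : ℝ} (hF0 : 0 ≤ F)
    (hF : ∀ ψ : EuclideanSpace ℂ (Fin n), ‖ψ‖ = 1 →
      ∑ i, ∑ j, (if i = j then 0 else
        ‖inner ℂ (toEuclideanCLM (𝕜 := ℂ) (U i) ψ) (toEuclideanCLM (𝕜 := ℂ) (U j) ψ)‖ ^ 2) ≤ F) :
    Real.log d - F / d ≤ minOutEntropy (ruChannel (fun _ => (1 / d : ℝ)) U) := by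
  have hd0 : (0 : ℝ) < d := by positivity
  have hw : ∑ _i : Fin d, (1 / d : ℝ) = 1 := by
    rw [Finset.sum_const, Finset.card_univ, Fintype.card_fin, nsmul_eq_mul,
      mul_one_div_cancel hd0.ne']
  refine le_csInf ⟨_, diagonal (Pi.single ⟨0, hn⟩ 1), ?_, ?_, rfl⟩ ?_
  · refine PosSemidef.diagonal fun i => ?_
    by_cases hi : i = ⟨0, hn⟩ <;> simp [hi]
  · simp [trace_diagonal]
  rintro _ ⟨ρ, hρ, htr, rfl⟩
  have hpure : ∀ ψ : EuclideanSpace ℂ (Fin n), ‖ψ‖ = 1 →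
      ‖ruChannelLinear (fun _ => (1 / d : ℝ)) U (vecMulVec ψ.ofLp (star ψ.ofLp))‖ ≤
        √((d + F) / d ^ 2) := by
    intro ψ hψ
    have h1 : ruChannelLinear (fun _ => (1 / d : ℝ)) U (vecMulVec ψ.ofLp (star ψ.ofLp)) =
        ((1 / d : ℝ) : ℂ) • ∑ i, vecMulVec (toEuclideanCLM (𝕜 := ℂ) (U i) ψ).ofLp
          (star (toEuclideanCLM (𝕜 := ℂ) (U i) ψ).ofLp) := by
      change ruChannel _ _ _ = _
      rw [ruChannel, Finset.smul_sum]
      refine Finset.sum_congr rfl fun i _ => ?_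
      rw [mul_vecMulVec, vecMulVec_mul, ofLp_toEuclideanCLM, star_mulVec]
    refine Real.le_sqrt_of_sq_le ?_
    rw [h1, norm_smul, mul_pow, frobenius_norm_sq_sum_vecMulVec, Complex.norm_real,
      Real.norm_eq_abs, sq_abs, one_div, inv_pow, inv_mul_eq_div]
    gcongr
    have hnorm : ∀ i, ‖toEuclideanCLM (𝕜 := ℂ) (U i) ψ‖ = 1 := fun i => by
      rw [Unitary.norm_map (⟨toEuclideanCLM (𝕜 := ℂ) (U i),
        Unitary.map_mem _ (hU i)⟩ : unitary (EuclideanSpace ℂ (Fin n) →L[ℂ] _)), hψ]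
    have hsplit : ∀ i j, ‖inner ℂ (toEuclideanCLM (𝕜 := ℂ) (U i) ψ)
        (toEuclideanCLM (𝕜 := ℂ) (U j) ψ)‖ ^ 2 = (if i = j then 1 else 0) +
          (if i = j then 0 else ‖inner ℂ (toEuclideanCLM (𝕜 := ℂ) (U i) ψ)
            (toEuclideanCLM (𝕜 := ℂ) (U j) ψ)‖ ^ 2) := by
      intro i j
      by_cases hij : i = j
      · subst hij
        rw [inner_self_eq_norm_sq_to_K, hnorm]
        simp
      · simp [hij]
    rw [Finset.sum_congr rfl fun i _ => Finset.sum_congr rfl fun j _ => hsplit i j]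
    simp only [Finset.sum_add_distrib]
    refine add_le_add (le_of_eq ?_) (hF ψ hψ)
    simp
  have hR := hρ.norm_map_le _ hpure htr
  have hent := log_add_one_sub_le_vnEntropy
    (posSemidef_ruChannel (w := fun _ => (1 / d : ℝ)) (fun _ => by positivity) U hρ)
    ((trace_ruChannel hw hU ρ).trans htr) hd0
  refine le_trans ?_ hent
  rw [← frobenius_norm_sq]
  have hsq : ‖ruChannel (fun _ => (1 / d : ℝ)) U ρ‖ ^ 2 ≤ (d + F) / d ^ 2 := by
    rw [← Real.sq_sqrt (show 0 ≤ (d + F) / (d : ℝ) ^ 2 by positivity)]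
    exact pow_le_pow_left₀ (norm_nonneg _) hR 2
  calc Real.log d - F / d = Real.log d + 1 - d * ((d + F) / d ^ 2) := by field_simp; ring
    _ ≤ _ := by gcongr

lemma exists_unitaryGroup_of_linearIsometryEquiv
    (V : EuclideanSpace ℂ (Fin n) ≃ₗᵢ[ℂ] EuclideanSpace ℂ (Fin n)) :
    ∃ U ∈ Matrix.unitaryGroup (Fin n) ℂ, ∀ ψ, toEuclideanCLM (𝕜 := ℂ) U ψ = V ψ := by
  let u := Unitary.linearIsometryEquiv.symm V
  let T := toEuclideanCLM (n := Fin n) (𝕜 := ℂ)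
  refine ⟨T.symm u, Unitary.map_mem T.symm u.2, fun ψ => ?_⟩
  change T (T.symm u) ψ = V ψ
  rw [T.apply_symm_apply]
  rfl

end Entropy

/-- There is a random unitary channel with input dimension `n < 7.8 × 10³²` whose
minimal output entropy exceeds `log d − (log d)/(2d)`. -/
theorem exists_channel_n_lt :
    ∃ (n d : ℕ) (w : Fin d → ℝ) (U : Fin d → Matrix (Fin n) (Fin n) ℂ),
      0 < n ∧ n < 78 * 10 ^ 31 ∧ 0 < d ∧
      (∀ i, 0 ≤ w i) ∧ ∑ i, w i = 1 ∧
      (∀ i, U i ∈ Matrix.unitaryGroup (Fin n) ℂ) ∧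
      Real.log d - Real.log d / (2 * d) < minOutEntropy (ruChannel w U) := by
  obtain ⟨n, hn⟩ : ∃ n : ℕ, n = 2 ^ 108 := ⟨_, rfl⟩
  obtain ⟨d, hd⟩ : ∃ d : ℕ, d = 2 ^ 45 := ⟨_, rfl⟩
  have hn0 : 0 < n := by rw [hn]; positivity
  have hd0 : 0 < d := by rw [hd]; positivity
  have hdr : (0 : ℝ) < d := by exact_mod_cast hd0
  have : FiniteDimensional ℝ (EuclideanSpace ℂ (Fin n)) := FiniteDimensional.complexToReal _
  obtain ⟨V, hV⟩ := exists_unitaries_sum_offDiag_lt (E := EuclideanSpace ℂ (Fin n))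
    (ι := Fin d) (by rw [Fintype.card_fin, hd]) (by rw [finrank_euclideanSpace_fin, hn])
  choose U hU hUV using fun i => exists_unitaryGroup_of_linearIsometryEquiv (V i)
  refine ⟨n, d, fun _ => 1 / d, U, hn0, by rw [hn]; norm_num, hd0, fun i => by positivity, ?_,
    hU, ?_⟩
  · rw [Finset.sum_const, Finset.card_univ, Fintype.card_fin, nsmul_eq_mul,
      mul_one_div_cancel hdr.ne']
  · refine lt_of_lt_of_le ?_ (log_sub_le_minOutEntropy (F := 3.8 ^ 2) hn0 hd0 hU (by positivity)
      fun ψ hψ => by simpa only [hUV] using hV ψ hψ)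
    have hlog : (2 * 3.8 ^ 2 : ℝ) < Real.log d := by
      rw [hd, Nat.cast_pow, Real.log_pow]
      have := Real.log_two_gt_d9
      norm_num
      linarith
    rw [← div_div]
    gcongr
    linarith
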